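/- Let W ≤ GL(V) be a finite complex reflection group of rank n with exponents m_1, ..., m_n. Then ∑_{w∈W} x^{dim V^w} = ∏_{i=1}^n (x + m_i), where V^w is the fixed subspace of w in V. -/

import Mathlib

open MvPolynomial

variable {n : ℕ}

/-- A (pseudo-)reflection: a non-trivial element of `GL(V)` of finite order
which fixes a hyperplane (a subspace of codimension one) pointwise. -/
def IsPseudoReflection (g : (Fin n → ℂ) ≃ₗ[ℂ] (Fin n → ℂ)) : Prop :=
  g ≠ 1 ∧ IsOfFinOrder g ∧
    ∃ H : Submodule ℂ (Fin n → ℂ),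
      Module.finrank ℂ H + 1 = n ∧ ∀ v ∈ H, g v = v

/-- The matrix of a linear automorphism of `Fin n → ℂ` in the standard basis. -/
noncomputable def glMatrix (g : (Fin n → ℂ) ≃ₗ[ℂ] (Fin n → ℂ)) :
    Matrix (Fin n) (Fin n) ℂ :=
  LinearMap.toMatrix (Pi.basisFun ℂ (Fin n)) (Pi.basisFun ℂ (Fin n)) g.toLinearMap

/-- The induced action of a linear automorphism on the algebra
`ℂ[V] = ℂ[X_1, ..., X_n]` of polynomial functions on `V`. -/
noncomputable def polyAct (g : (Fin n → ℂ) ≃ₗ[ℂ] (Fin n → ℂ)) :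
    MvPolynomial (Fin n) ℂ →ₐ[ℂ] MvPolynomial (Fin n) ℂ :=
  MvPolynomial.aeval fun i => ∑ j, MvPolynomial.C (glMatrix g i j) * MvPolynomial.X j

/-- The subalgebra `ℂ[V]^W` of `W`-invariant polynomials. -/
noncomputable def invariantsAlg (W : Subgroup ((Fin n → ℂ) ≃ₗ[ℂ] (Fin n → ℂ))) :
    Subalgebra ℂ (MvPolynomial (Fin n) ℂ) where
  carrier := {p | ∀ g ∈ W, polyAct g p = p}
  mul_mem' := by
    intro a b ha hb g hg
    simp only [map_mul, ha g hg, hb g hg]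
  add_mem' := by
    intro a b ha hb g hg
    simp only [map_add, ha g hg, hb g hg]
  algebraMap_mem' := by
    intro r g hg
    simp [polyAct]

/-- `W` is a (complex) reflection group: it is generated by the
pseudo-reflections it contains. -/
def IsReflectionGroup (W : Subgroup ((Fin n → ℂ) ≃ₗ[ℂ] (Fin n → ℂ))) : Prop :=
  Subgroup.closure {g | g ∈ W ∧ IsPseudoReflection g} = W

/-- `f` is a system of basic invariants of `W` with degrees `d`: the `f i` are
`W`-invariant, homogeneous of degree `d i`, algebraically independent, and they
generate the algebra of invariants `ℂ[V]^W`. -/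
def IsBasicInvariants (W : Subgroup ((Fin n → ℂ) ≃ₗ[ℂ] (Fin n → ℂ)))
    (f : Fin n → MvPolynomial (Fin n) ℂ) (d : Fin n → ℕ) : Prop :=
  (∀ i, f i ∈ invariantsAlg W) ∧
  (∀ i, (f i).IsHomogeneous (d i)) ∧
  Function.Injective (MvPolynomial.aeval (R := ℂ) f) ∧
  (MvPolynomial.aeval (R := ℂ) f).range = invariantsAlg W

/-- The fixed space `V^w` of a linear automorphism `w`. -/
noncomputable def fixedSpace (w : (Fin n → ℂ) ≃ₗ[ℂ] (Fin n → ℂ)) :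
    Submodule ℂ (Fin n → ℂ) :=
  LinearMap.eqLocus w.toLinearMap LinearMap.id

section

/-- An endomorphism whose range is spanned by linearly independent eigenvectors has trace the sum
of the corresponding eigenvalues. -/
theorem LinearMap.trace_eq_sum_of_range_le_span {K U N : Type*} [Field K] [AddCommGroup U]
    [Module K U] [FiniteDimensional K U] [Fintype N] (Z : U →ₗ[K] U) (b : N → U) (y : N → K)
    (hb : LinearIndependent K b) (hZ : ∀ u, Z u ∈ Submodule.span K (Set.range b))
    (hy : ∀ j, Z (b j) = y j • b j) : LinearMap.trace K U Z = ∑ j, y j := by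
  classical
  rw [← LinearMap.trace_restrict_eq_of_forall_mem _ Z hZ (fun u _ => hZ u),
    LinearMap.trace_eq_matrix_trace K (Module.Basis.span hb), Matrix.trace]
  refine Finset.sum_congr rfl fun j _ => ?_
  have h : Z.restrict (fun u _ => hZ u) (Module.Basis.span hb j) =
      y j • Module.Basis.span hb j := by
    ext
    simp [Module.Basis.span_apply, hy]
  rw [Matrix.diag_apply, LinearMap.toMatrix_apply, h, map_smul]
  simp [-map_smul]

theorem exists_basis_eigenvectors {T : Module.End ℂ (Fin n → ℂ)} {N : ℕ} (hN : 0 < N)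
    (hT : T ^ N = 1) :
    ∃ (b : Module.Basis (Fin n) ℂ (Fin n → ℂ)) (l : Fin n → ℂ), ∀ i, T (b i) = l i • b i := by
  classical
  have hss : T.IsSemisimple := by
    refine Module.End.isSemisimple_of_squarefree_aeval_eq_zero
      (p := (Polynomial.X ^ N - 1 : Polynomial ℂ)) ?_ (by simp [hT])
    exact (Polynomial.separable_X_pow_sub_C (n := N) (1 : ℂ) (by exact_mod_cast hN.ne')
      one_ne_zero).squarefree
  have hds := DirectSum.isInternal_submodule_of_iSupIndep_of_iSup_eq_top
    T.eigenspaces_iSupIndep hss.iSup_eigenspace_eq_top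
  let c := hds.collectedBasis fun μ => Module.finBasis ℂ (T.eigenspace μ)
  let e := c.indexEquiv (Pi.basisFun ℂ (Fin n))
  refine ⟨c.reindex e, fun i => (e.symm i).1, fun i => ?_⟩
  have := hds.collectedBasis_mem (fun μ => Module.finBasis ℂ (T.eigenspace μ)) (e.symm i)
  rw [Module.End.mem_eigenspace_iff] at this
  simpa [c] using this

theorem glMatrix_mul (g h : (Fin n → ℂ) ≃ₗ[ℂ] (Fin n → ℂ)) :
    glMatrix (g * h) = glMatrix g * glMatrix h := by
  simp only [glMatrix]
  rw [← LinearMap.toMatrix_mul]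
  rfl

theorem glMatrix_one : glMatrix (1 : (Fin n → ℂ) ≃ₗ[ℂ] (Fin n → ℂ)) = 1 :=
  LinearMap.toMatrix_one _

/-- A linear automorphism of finite order is diagonalizable, and the dimension of its fixed space
is the number of eigenvalues equal to `1`. -/
theorem exists_diagonal_of_isOfFinOrder (g : (Fin n → ℂ) ≃ₗ[ℂ] (Fin n → ℂ))
    (hg : IsOfFinOrder g) :
    ∃ (P Q : Matrix (Fin n) (Fin n) ℂ) (l : Fin n → ℂ), P * Q = 1 ∧ Q * P = 1 ∧
      glMatrix g = P * Matrix.diagonal l * Q ∧ (∀ i, ‖l i‖ = 1) ∧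
      Module.finrank ℂ (fixedSpace g) = (Finset.univ.filter fun i => l i = 1).card := by
  classical
  obtain ⟨N, hN, hgN⟩ := isOfFinOrder_iff_pow_eq_one.1 hg
  have hpow : ∀ k : ℕ, (g ^ k).toLinearMap = (g.toLinearMap : Module.End ℂ (Fin n → ℂ)) ^ k := by
    intro k
    induction k with
    | zero => rfl
    | succ k ih => rw [pow_succ, pow_succ, ← ih]; rfl
  have hT : (g.toLinearMap : Module.End ℂ (Fin n → ℂ)) ^ N = 1 := by
    rw [← hpow, hgN]; rfl
  obtain ⟨b, l, hl⟩ := exists_basis_eigenvectors hN hT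
  have hdiag : LinearMap.toMatrix b b g.toLinearMap = Matrix.diagonal l := by
    ext i j
    rw [LinearMap.toMatrix_apply, hl]
    by_cases h : i = j
    · subst h; simp
    · simp [h]
  set P := (Pi.basisFun ℂ (Fin n)).toMatrix b
  set Q := b.toMatrix (Pi.basisFun ℂ (Fin n))
  have hPQ : P * Q = 1 := by simp [P, Q]
  have hQP : Q * P = 1 := by simp [P, Q]
  have hG : glMatrix g = P * Matrix.diagonal l * Q := by
    rw [← hdiag, glMatrix, basis_toMatrix_mul_linearMap_toMatrix_mul_basis_toMatrix]
  refine ⟨P, Q, l, hPQ, hQP, hG, fun i => ?_, ?_⟩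
  · have h1 : ∀ k : ℕ, ((g.toLinearMap : Module.End ℂ (Fin n → ℂ)) ^ k) (b i) = l i ^ k • b i := by
      intro k
      induction k with
      | zero => simp
      | succ k ih => rw [pow_succ', Module.End.mul_apply, ih, map_smul, hl, smul_smul, pow_succ]
    have h2 := h1 N
    rw [hT] at h2
    have h3 : (l i ^ N - 1) • b i = 0 := by rw [sub_smul, ← h2]; simp
    rcases smul_eq_zero.1 h3 with h | h
    · exact Complex.norm_eq_one_of_pow_eq_one (sub_eq_zero.1 h) hN.ne'
    · exact absurd h (b.ne_zero i)
  · have hfix : fixedSpace g = LinearMap.ker (g.toLinearMap - LinearMap.id) := by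
      ext v; simp [fixedSpace, sub_eq_zero]
    have hmat : g.toLinearMap - LinearMap.id = Matrix.toLin' (P * (Matrix.diagonal l - 1) * Q) := by
      rw [mul_sub, sub_mul, ← hG, mul_one, hPQ, map_sub, Matrix.toLin'_one]
      congr 1
      rw [glMatrix, ← Matrix.toLin_eq_toLin', Matrix.toLin_toMatrix]
    have hP : IsUnit P.det := by
      rw [← Matrix.isUnit_iff_isUnit_det]; exact IsUnit.of_mul_eq_one _ hPQ
    have hQ : IsUnit Q.det := by
      rw [← Matrix.isUnit_iff_isUnit_det]; exact IsUnit.of_mul_eq_one _ hQP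
    have hrk : Module.finrank ℂ (LinearMap.range (g.toLinearMap - LinearMap.id)) =
        Fintype.card {i // l i - 1 ≠ 0} := by
      rw [hmat]
      change Matrix.rank _ = _
      rw [Matrix.rank_mul_eq_left_of_isUnit_det _ _ hQ,
        Matrix.rank_mul_eq_right_of_isUnit_det _ _ hP,
        ← Matrix.diagonal_one, Matrix.diagonal_sub, Matrix.rank_diagonal]
    have hsum := LinearMap.finrank_range_add_finrank_ker (g.toLinearMap - LinearMap.id)
    rw [hrk, ← hfix, Module.finrank_fin_fun, Fintype.card_subtype] at hsum
    have h1 := Finset.card_filter_add_card_filter_not (s := (Finset.univ : Finset (Fin n)))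
      (fun i => l i = 1)
    have h2 : (Finset.univ.filter fun i => l i - 1 ≠ 0) = Finset.univ.filter fun i => ¬ l i = 1 :=
      Finset.filter_congr fun i _ => sub_ne_zero
    rw [h2] at hsum
    simp only [Finset.card_univ, Fintype.card_fin] at h1
    omega

/-- The linear substitution `X i ↦ ∑ j, M i j * X j`. -/
noncomputable def linSubst (M : Matrix (Fin n) (Fin n) ℂ) :
    MvPolynomial (Fin n) ℂ →ₐ[ℂ] MvPolynomial (Fin n) ℂ :=
  MvPolynomial.aeval fun i => ∑ j, MvPolynomial.C (M i j) * MvPolynomial.X j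

theorem linSubst_X (M : Matrix (Fin n) (Fin n) ℂ) (i : Fin n) :
    linSubst M (X i) = ∑ j, C (M i j) * X j := by
  simp [linSubst]

theorem linSubst_comp (M N : Matrix (Fin n) (Fin n) ℂ) :
    (linSubst M).comp (linSubst N) = linSubst (N * M) := by
  ext1 i
  simp only [AlgHom.comp_apply, linSubst_X, map_sum, map_mul, Matrix.mul_apply, Finset.sum_mul,
    Finset.mul_sum, algHom_C, ← mul_assoc]
  exact Finset.sum_comm

theorem linSubst_one : linSubst (1 : Matrix (Fin n) (Fin n) ℂ) = AlgHom.id ℂ _ := by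
  ext1 i
  simp [linSubst_X, Matrix.one_apply]

theorem linSubst_diagonal_monomial (l : Fin n → ℂ) (a : Fin n →₀ ℕ) :
    linSubst (Matrix.diagonal l) (monomial a 1) = (∏ i, l i ^ a i) • monomial a (1 : ℂ) := by
  have h : ∀ i, linSubst (Matrix.diagonal l) (X i) = C (l i) * X i := by
    intro i
    rw [linSubst_X, Finset.sum_eq_single i] <;> simp +contextual [eq_comm]
  rw [monomial_eq, C_1, one_mul, Finsupp.prod_fintype _ _ (by simp), map_prod, smul_eq_C_mul,
    map_prod, ← Finset.prod_mul_distrib]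
  simp [h, mul_pow]

theorem linSubst_isHomogeneous (M : Matrix (Fin n) (Fin n) ℂ) {k : ℕ}
    {p : MvPolynomial (Fin n) ℂ} (hp : p.IsHomogeneous k) : (linSubst M p).IsHomogeneous k := by
  have := hp.aeval (fun i => ∑ j, C (M i j) * X j) (n := 1) fun i =>
    IsHomogeneous.sum _ _ _ fun j _ => by simpa using (isHomogeneous_X ℂ j).C_mul (M i j)
  simpa [linSubst] using this

/-- The action of a linear substitution on the homogeneous polynomials of degree `k`. -/
noncomputable def linSubstHom (k : ℕ) (M : Matrix (Fin n) (Fin n) ℂ) :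
    homogeneousSubmodule (Fin n) ℂ k →ₗ[ℂ] homogeneousSubmodule (Fin n) ℂ k :=
  (linSubst M).toLinearMap.restrict fun _ hp => linSubst_isHomogeneous M hp

@[simp]
theorem coe_linSubstHom (k : ℕ) (M : Matrix (Fin n) (Fin n) ℂ)
    (p : homogeneousSubmodule (Fin n) ℂ k) :
    (linSubstHom k M p : MvPolynomial (Fin n) ℂ) = linSubst M p := rfl

theorem linSubstHom_comp (k : ℕ) (M N : Matrix (Fin n) (Fin n) ℂ) :
    linSubstHom k M ∘ₗ linSubstHom k N = linSubstHom k (N * M) := by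
  ext1 p
  apply Subtype.ext
  simp [← linSubst_comp]

instance (k : ℕ) : FiniteDimensional ℂ (homogeneousSubmodule (Fin n) ℂ k) :=
  Module.Finite.iff_fg.2 (homogeneousSubmodule_fg _ _ k)

/-- The exponents of weighted degree `k`, for positive weights `d`. -/
noncomputable def weightFinset (d : Fin n → ℕ) (hd : ∀ i, d i ≠ 0) (k : ℕ) :
    Finset (Fin n →₀ ℕ) :=
  (Finsupp.finite_of_nat_weight_eq d hd k).toFinset

@[simp]
theorem mem_weightFinset {d : Fin n → ℕ} {hd : ∀ i, d i ≠ 0} {k : ℕ} {a : Fin n →₀ ℕ} :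
    a ∈ weightFinset d hd k ↔ Finsupp.weight d a = k := by
  simp [weightFinset]

theorem one_weight_ne_zero (i : Fin n) : (1 : Fin n → ℕ) i ≠ 0 := one_ne_zero

theorem trace_linSubstHom_diagonal (k : ℕ) (l : Fin n → ℂ) :
    LinearMap.trace ℂ _ (linSubstHom k (Matrix.diagonal l)) =
      ∑ a ∈ weightFinset 1 one_weight_ne_zero k, ∏ i, l i ^ a i := by
  classical
  rw [← Finset.sum_coe_sort]
  let b : weightFinset (n := n) 1 one_weight_ne_zero k → homogeneousSubmodule (Fin n) ℂ k :=
    fun a => ⟨monomial a.1 1, isWeightedHomogeneous_monomial _ _ _ (mem_weightFinset.1 a.2)⟩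
  refine LinearMap.trace_eq_sum_of_range_le_span _ b _ ?_ ?_ ?_
  · refine LinearIndependent.of_comp (Submodule.subtype _) ?_
    have h := (basisMonomials (Fin n) ℂ).linearIndependent
    rw [coe_basisMonomials] at h
    exact h.comp (fun a : weightFinset (n := n) 1 one_weight_ne_zero k => a.1)
      Subtype.val_injective
  · have htop : ∀ u, u ∈ Submodule.span ℂ (Set.range b) := by
      intro u
      have hu : (u : MvPolynomial (Fin n) ℂ) =
          ∑ a : u.1.support, coeff a.1 u.1 • monomial a.1 1 := by
        conv_lhs => rw [u.1.as_sum]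
        rw [← Finset.sum_coe_sort]
        exact Finset.sum_congr rfl fun a _ => by rw [smul_monomial, smul_eq_mul, mul_one]
      have hw : ∀ a : u.1.support, Finsupp.weight (1 : Fin n → ℕ) a.1 = k :=
        fun a => u.2 (mem_support_iff.1 a.2)
      have hu' : u = ∑ a : u.1.support, coeff a.1 u.1 • b ⟨a.1, mem_weightFinset.2 (hw a)⟩ := by
        apply Subtype.ext
        simpa [b] using hu
      rw [hu']
      exact Submodule.sum_mem _ fun a _ => Submodule.smul_mem _ _ (Submodule.subset_span ⟨_, rfl⟩)
    exact fun u => htop _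
  · intro a
    apply Subtype.ext
    simpa [b] using linSubst_diagonal_monomial l a.1

theorem trace_linSubstHom_conj (k : ℕ) {P Q : Matrix (Fin n) (Fin n) ℂ} (h : Q * P = 1)
    (D : Matrix (Fin n) (Fin n) ℂ) :
    LinearMap.trace ℂ _ (linSubstHom k (P * D * Q)) = LinearMap.trace ℂ _ (linSubstHom k D) := by
  rw [mul_assoc, ← linSubstHom_comp, LinearMap.trace_comp_comm', linSubstHom_comp, mul_assoc,
    h, mul_one]

/-- The endomorphism of the exterior algebra induced by `ι (e i) ↦ ∑ j, M i j • ι (e j)`. -/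
noncomputable def extMap (M : Matrix (Fin n) (Fin n) ℂ) :
    ExteriorAlgebra ℂ (Fin n → ℂ) →ₐ[ℂ] ExteriorAlgebra ℂ (Fin n → ℂ) :=
  ExteriorAlgebra.map (Matrix.toLin' M.transpose)

theorem extMap_comp (M N : Matrix (Fin n) (Fin n) ℂ) :
    (extMap M).comp (extMap N) = extMap (N * M) := by
  rw [extMap, extMap, ExteriorAlgebra.map_comp_map, ← Matrix.toLin'_mul, ← Matrix.transpose_mul,
    extMap]

theorem extMap_ι (M : Matrix (Fin n) (Fin n) ℂ) (i : Fin n) :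
    extMap M (ExteriorAlgebra.ι ℂ (Pi.single i 1)) =
      ∑ j, M i j • ExteriorAlgebra.ι ℂ (Pi.single j 1 : Fin n → ℂ) := by
  rw [extMap, ExteriorAlgebra.map_apply_ι, Matrix.toLin'_apply]
  have : M.transpose.mulVec (Pi.single i 1) = ∑ j, M i j • (Pi.single j 1 : Fin n → ℂ) := by
    ext j
    simp [Finset.sum_apply, Pi.single_apply]
  rw [this, map_sum]
  simp

/-- The standard basis of the exterior algebra, indexed by subsets. -/
noncomputable def extBasis (n : ℕ) :
    Module.Basis (Finset (Fin n)) ℂ (ExteriorAlgebra ℂ (Fin n → ℂ)) :=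
  (Pi.basisFun ℂ (Fin n)).ExteriorAlgebra

instance : FiniteDimensional ℂ (ExteriorAlgebra ℂ (Fin n → ℂ)) :=
  Module.Finite.of_basis (extBasis n)

/-- A basis vector of the exterior algebra is a product of distinct generators. -/
theorem exists_extBasis_eq_prod (s : Finset (Fin n)) :
    ∃ L : List (Fin n), L.Nodup ∧ L.toFinset = s ∧ extBasis n s =
      (L.map fun i => ExteriorAlgebra.ι ℂ (Pi.single i 1 : Fin n → ℂ)).prod := by
  let t : Set.powersetCard (Fin n) s.card := Set.powersetCard.ofCard rfl
  refine ⟨List.ofFn (Set.powersetCard.ofFinEmbEquiv.symm t), ?_, ?_, ?_⟩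
  · exact List.nodup_ofFn.2 (RelEmbedding.injective _)
  · ext i
    rw [List.mem_toFinset, List.mem_ofFn]
    exact Set.powersetCard.mem_range_ofFinEmbEquiv_symm_iff_mem t i
  · rw [extBasis, ExteriorAlgebra.basis_apply_ofCard (n := s.card) _ rfl,
      ExteriorAlgebra.ιMulti_family, ExteriorAlgebra.ιMulti_apply, List.map_ofFn]
    congr 2
    ext j
    simp [t]

theorem extMap_diagonal_extBasis (l : Fin n → ℂ) (s : Finset (Fin n)) :
    extMap (Matrix.diagonal l) (extBasis n s) = (∏ i ∈ s, l i) • extBasis n s := by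
  obtain ⟨L, hL, rfl, h⟩ := exists_extBasis_eq_prod s
  have hι : ∀ i, extMap (Matrix.diagonal l) (ExteriorAlgebra.ι ℂ (Pi.single i 1)) =
      l i • ExteriorAlgebra.ι ℂ (Pi.single i 1 : Fin n → ℂ) := by
    intro i
    rw [extMap_ι, Finset.sum_eq_single i] <;> simp +contextual [eq_comm]
  rw [h, List.prod_toFinset _ hL, map_list_prod]
  clear h hL
  induction L with
  | nil => simp
  | cons i L ih =>
    simp only [List.map_cons, List.prod_cons] at ih ⊢
    rw [ih, hι, smul_mul_smul_comm]

theorem trace_extMap_conj {P Q : Matrix (Fin n) (Fin n) ℂ} (h : Q * P = 1) (l : Fin n → ℂ) :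
    LinearMap.trace ℂ _ (extMap (P * Matrix.diagonal l * Q)).toLinearMap = ∏ i, (1 + l i) := by
  rw [mul_assoc, ← extMap_comp, AlgHom.comp_toLinearMap, LinearMap.trace_comp_comm',
    ← AlgHom.comp_toLinearMap, extMap_comp, mul_assoc, h, mul_one, Finset.prod_one_add,
    Finset.powerset_univ]
  refine LinearMap.trace_eq_sum_of_range_le_span _ (extBasis n) _ (extBasis n).linearIndependent
    (fun u => ?_) fun s => extMap_diagonal_extBasis l s
  rw [(extBasis n).span_eq]
  trivial

/-- The generating function of the monomials in `z`, graded by the weights `d`. -/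
noncomputable def weightSeries (d : Fin n → ℕ) (hd : ∀ i, d i ≠ 0) (z : Fin n → ℂ) :
    PowerSeries ℂ :=
  PowerSeries.mk fun k => ∑ a ∈ weightFinset d hd k, ∏ i, z i ^ a i

theorem PowerSeries.mk_dvd_pow_mul_one_sub_C_mul_X_pow {d : ℕ} (hd : d ≠ 0) (z : ℂ) :
    PowerSeries.mk (fun j => if d ∣ j then z ^ (j / d) else 0) *
      (1 - PowerSeries.C z * PowerSeries.X ^ d) = 1 := by
  ext j
  rw [mul_sub, mul_one, ← mul_assoc, map_sub, PowerSeries.coeff_mul_X_pow',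
    PowerSeries.coeff_mul_C, PowerSeries.coeff_mk, PowerSeries.coeff_mk, PowerSeries.coeff_one]
  by_cases hj : j = 0
  · subst hj
    simp [hd]
  by_cases hdj : d ≤ j
  · obtain ⟨r, rfl⟩ := Nat.exists_eq_add_of_le hdj
    rw [if_pos hdj, if_neg hj, Nat.add_sub_cancel_left]
    by_cases hr : d ∣ r
    · rw [if_pos ((Nat.dvd_add_right (dvd_refl d)).2 hr), if_pos hr,
        Nat.add_div_left _ (Nat.pos_of_ne_zero hd), pow_succ, sub_self]
    · rw [if_neg fun h => hr ((Nat.dvd_add_right (dvd_refl d)).1 h), if_neg hr, zero_mul, sub_zero]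
  · rw [if_neg hdj, if_neg hj, if_neg fun h => hdj (Nat.le_of_dvd (Nat.pos_of_ne_zero hj) h),
      sub_zero]

theorem weightSeries_eq_prod (d : Fin n → ℕ) (hd : ∀ i, d i ≠ 0) (z : Fin n → ℂ) :
    weightSeries d hd z =
      ∏ i, PowerSeries.mk (fun j => if d i ∣ j then z i ^ (j / d i) else 0) := by
  classical
  ext k
  rw [PowerSeries.coeff_prod, weightSeries, PowerSeries.coeff_mk]
  simp only [PowerSeries.coeff_mk]
  symm
  rw [← Finset.sum_filter_of_ne (p := fun l : Fin n →₀ ℕ => ∀ i, d i ∣ l i)]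
  · refine Finset.sum_nbij' (fun l => Finsupp.equivFunOnFinite.symm fun i => l i / d i)
      (fun a => Finsupp.equivFunOnFinite.symm fun i => d i * a i) ?_ ?_ ?_ ?_ ?_
    · intro l hl
      simp only [Finset.mem_filter, Finset.mem_finsuppAntidiag] at hl
      rw [mem_weightFinset, Finsupp.weight_apply, Finsupp.sum_fintype _ _ (by simp), ← hl.1.1]
      exact Finset.sum_congr rfl fun i _ => by simpa using Nat.div_mul_cancel (hl.2 i)
    · intro a ha
      simp only [Finset.mem_filter, Finset.mem_finsuppAntidiag]
      rw [mem_weightFinset, Finsupp.weight_apply, Finsupp.sum_fintype _ _ (by simp)] at ha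
      exact ⟨⟨by rw [← ha]; exact Finset.sum_congr rfl fun i _ => by simp [mul_comm], by simp⟩,
        fun i => by simp⟩
    · intro l hl
      ext i
      simpa using Nat.mul_div_cancel' ((Finset.mem_filter.1 hl).2 i)
    · intro a ha
      ext i
      simpa using Nat.mul_div_cancel_left _ (Nat.pos_of_ne_zero (hd i))
    · intro l hl
      exact Finset.prod_congr rfl fun i _ => by simp [(Finset.mem_filter.1 hl).2 i]
  · intro l _ h i
    by_contra hi
    exact h (Finset.prod_eq_zero (Finset.mem_univ i) (if_neg hi))

theorem weightSeries_mul (d : Fin n → ℕ) (hd : ∀ i, d i ≠ 0) (z : Fin n → ℂ) :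
    weightSeries d hd z *
      ((∏ i, (1 - Polynomial.C (z i) * Polynomial.X ^ d i) : Polynomial ℂ) :
        PowerSeries ℂ) = 1 := by
  have h : ((∏ i, (1 - Polynomial.C (z i) * Polynomial.X ^ d i) : Polynomial ℂ) : PowerSeries ℂ) =
      ∏ i, (1 - PowerSeries.C (z i) * PowerSeries.X ^ d i) := by
    rw [← Polynomial.coeToPowerSeries.ringHom_apply, map_prod]
    simp
  rw [h, weightSeries_eq_prod, ← Finset.prod_mul_distrib]
  exact Finset.prod_eq_one fun i _ => PowerSeries.mk_dvd_pow_mul_one_sub_C_mul_X_pow (hd i) (z i)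

/-- A linear relation between quotients of polynomials, with denominators invertible as power
series, holds if and only if it holds for all values of the variable outside the zeros of the
denominators. -/
theorem sum_mul_inv_eq_iff {ι : Type*} [Fintype ι] (N D : ι → Polynomial ℂ) (B Q : Polynomial ℂ)
    (H : ι → PowerSeries ℂ) (K : PowerSeries ℂ) (hH : ∀ i, H i * D i = 1) (hK : K * Q = 1)
    (s : Set ℂ) (hs : s.Infinite)
    (hsD : ∀ t ∈ s, ∀ i, (D i).eval t ≠ 0) (hsQ : ∀ t ∈ s, Q.eval t ≠ 0) :
    ∑ i, (N i : PowerSeries ℂ) * H i = B * K ↔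
      ∀ t ∈ s, ∑ i, (N i).eval t / (D i).eval t = B.eval t / Q.eval t := by
  classical
  set E : Polynomial ℂ := (∑ i, N i * ∏ j ∈ Finset.univ.erase i, D j) * Q
  set F : Polynomial ℂ := B * ∏ i, D i
  have hprod : ∀ i, ((∏ j, D j : Polynomial ℂ) : PowerSeries ℂ) =
      D i * ((∏ j ∈ Finset.univ.erase i, D j : Polynomial ℂ) : PowerSeries ℂ) := by
    intro i
    rw [← Polynomial.coe_mul, Finset.mul_prod_erase _ _ (Finset.mem_univ i)]
  have hunit : IsUnit (((∏ i, D i : Polynomial ℂ) : PowerSeries ℂ) * Q) := by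
    refine IsUnit.mul ?_ (IsUnit.of_mul_eq_one_right _ hK)
    rw [← Polynomial.coeToPowerSeries.ringHom_apply, map_prod, IsUnit.prod_univ_iff]
    exact fun i => IsUnit.of_mul_eq_one_right _ (hH i)
  have h1 : ∑ i, (N i : PowerSeries ℂ) * H i = B * K ↔ E = F := by
    rw [← hunit.mul_left_inj, ← Polynomial.coe_inj (φ := E)]
    have e1 : (∑ i, (N i : PowerSeries ℂ) * H i) *
        (((∏ i, D i : Polynomial ℂ) : PowerSeries ℂ) * Q) = E := by
      rw [Polynomial.coe_mul, ← mul_assoc, Finset.sum_mul,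
        ← Polynomial.coeToPowerSeries.ringHom_apply (φ := ∑ i, _), map_sum]
      congr 1
      refine Finset.sum_congr rfl fun i _ => ?_
      rw [Polynomial.coeToPowerSeries.ringHom_apply, Polynomial.coe_mul, hprod i]
      linear_combination (N i : PowerSeries ℂ) *
        ((∏ j ∈ Finset.univ.erase i, D j : Polynomial ℂ) : PowerSeries ℂ) * hH i
    have e2 : (B : PowerSeries ℂ) * K *
        (((∏ i, D i : Polynomial ℂ) : PowerSeries ℂ) * Q) = F := by
      rw [Polynomial.coe_mul]
      linear_combination (B : PowerSeries ℂ) * ((∏ i, D i : Polynomial ℂ) : PowerSeries ℂ) * hK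
    rw [e1, e2]
  have h2 : ∀ t ∈ s, ∑ i, (N i).eval t / (D i).eval t = B.eval t / Q.eval t ↔
      E.eval t = F.eval t := by
    intro t ht
    have hP : ∏ i, (D i).eval t ≠ 0 := Finset.prod_ne_zero_iff.2 fun i _ => hsD t ht i
    have e1 : ∑ i, (N i).eval t / (D i).eval t =
        (∑ i, (N i).eval t * ∏ j ∈ Finset.univ.erase i, (D j).eval t) / ∏ i, (D i).eval t := by
      rw [Finset.sum_div]
      refine Finset.sum_congr rfl fun i _ => ?_
      rw [div_eq_div_iff (hsD t ht i) hP, ← Finset.mul_prod_erase _ _ (Finset.mem_univ i)]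
      ring
    rw [e1, div_eq_div_iff hP (hsQ t ht)]
    simp [E, F, Polynomial.eval_finsetSum, Polynomial.eval_prod]
  rw [h1]
  refine ⟨fun h t ht => (h2 t ht).2 (by rw [h]), fun h => ?_⟩
  exact Polynomial.eq_of_infinite_eval_eq _ _ (hs.mono fun t ht => (h2 t ht).1 (h t ht))

section Average

variable {W U N : Type*} [Group W] [Fintype W] [AddCommGroup U] [Module ℂ U]
  [Fintype N] (ρ : W → Module.End ℂ U)

/-- The average of the operators of a finite (right) group action. -/
noncomputable def averageMap : Module.End ℂ U := (Fintype.card W : ℂ)⁻¹ • ∑ w, ρ w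

theorem averageMap_invariant (hmul : ∀ v w, ρ v ∘ₗ ρ w = ρ (w * v)) (v : W) (u : U) :
    ρ v (averageMap ρ u) = averageMap ρ u := by
  have h : ρ v ∘ₗ averageMap ρ = averageMap ρ := by
    rw [averageMap, LinearMap.comp_smul, ← Module.End.mul_eq_comp, Finset.mul_sum]
    congr 1
    simp only [Module.End.mul_eq_comp, hmul]
    exact Fintype.sum_equiv (Equiv.mulRight v) _ _ fun _ => rfl
  exact LinearMap.congr_fun h u

theorem averageMap_of_invariant {u : U} (hu : ∀ w, ρ w u = u) : averageMap ρ u = u := by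
  simp [averageMap, hu, ← Nat.cast_smul_eq_nsmul ℂ, smul_smul]

theorem card_mul_trace_averageMap_comp (Y : Module.End ℂ U) :
    Fintype.card W * LinearMap.trace ℂ U (averageMap ρ ∘ₗ Y) =
      ∑ w, LinearMap.trace ℂ U (ρ w ∘ₗ Y) := by
  rw [averageMap, LinearMap.smul_comp, ← Module.End.mul_eq_comp, Finset.sum_mul, map_smul,
    map_sum, smul_eq_mul, mul_inv_cancel_left₀ (by simp)]
  simp only [Module.End.mul_eq_comp]

theorem sum_trace_comp_eq [FiniteDimensional ℂ U] (hmul : ∀ v w, ρ v ∘ₗ ρ w = ρ (w * v))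
    (Y : Module.End ℂ U)
    (b : N → U) (y : N → ℂ) (hb : LinearIndependent ℂ b) (hρ : ∀ w j, ρ w (b j) = b j)
    (hspan : ∀ u, (∀ w, ρ w u = u) → u ∈ Submodule.span ℂ (Set.range b))
    (hY : ∀ j, Y (b j) = y j • b j) :
    ∑ w, LinearMap.trace ℂ U (ρ w ∘ₗ Y) = Fintype.card W * ∑ j, y j := by
  rw [← card_mul_trace_averageMap_comp,
    LinearMap.trace_eq_sum_of_range_le_span (averageMap ρ ∘ₗ Y) b y hb]
  · exact fun u => hspan _ fun w => averageMap_invariant ρ hmul w _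
  · intro j
    rw [LinearMap.comp_apply, hY, map_smul, averageMap_of_invariant ρ fun w => hρ w j]

theorem mem_span_of_sum_trace_eq [FiniteDimensional ℂ U] (hmul : ∀ v w, ρ v ∘ₗ ρ w = ρ (w * v))
    (b : N → U) (hb : LinearIndependent ℂ b) (hρ : ∀ w j, ρ w (b j) = b j)
    (htr : ∑ w, LinearMap.trace ℂ U (ρ w) = Fintype.card W * Fintype.card N)
    {u : U} (hu : ∀ w, ρ w u = u) : u ∈ Submodule.span ℂ (Set.range b) := by
  let p : Submodule ℂ U := LinearMap.range (averageMap ρ)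
  have hp : ∀ v, (∀ w, ρ w v = v) → v ∈ p := fun v hv => ⟨v, averageMap_of_invariant ρ hv⟩
  have hproj : LinearMap.IsProj p (averageMap ρ) :=
    ⟨fun v => ⟨v, rfl⟩, by
      rintro _ ⟨v, rfl⟩
      exact averageMap_of_invariant ρ fun w => averageMap_invariant ρ hmul w v⟩
  have h1 : (Module.finrank ℂ p : ℂ) = Fintype.card N := by
    rw [← hproj.trace]
    have h := card_mul_trace_averageMap_comp ρ LinearMap.id
    simp only [LinearMap.comp_id] at h
    rw [htr] at h
    exact mul_left_cancel₀ (by simp) h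
  have hle : Submodule.span ℂ (Set.range b) ≤ p :=
    Submodule.span_le.2 (by rintro _ ⟨j, rfl⟩; exact hp _ fun w => hρ w j)
  have heq : Submodule.span ℂ (Set.range b) = p := by
    refine Submodule.eq_of_le_of_finrank_eq hle ?_
    rw [finrank_span_eq_card hb]
    exact_mod_cast h1.symm
  rw [heq]
  exact hp u hu

end Average

variable {W : Subgroup ((Fin n → ℂ) ≃ₗ[ℂ] (Fin n → ℂ))} {f : Fin n → MvPolynomial (Fin n) ℂ}
  {d : Fin n → ℕ}

theorem IsBasicInvariants.degree_ne_zero (hf : IsBasicInvariants W f d) (i : Fin n) :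
    d i ≠ 0 := by
  intro hi
  have h := hf.2.1 i
  rw [hi] at h
  have hc : f i = C (coeff 0 (f i)) :=
    totalDegree_eq_zero_iff_eq_C.1 ((totalDegree_zero_iff_isHomogeneous _).2 h)
  have h2 : aeval f (X i : MvPolynomial (Fin n) ℂ) =
      aeval f (C (coeff 0 (f i)) : MvPolynomial (Fin n) ℂ) := by
    rw [aeval_X, aeval_C]
    exact hc
  have h3 := congrArg totalDegree (hf.2.2.1 h2)
  simp at h3

theorem IsBasicInvariants.isHomogeneous_aeval_monomial (hf : IsBasicInvariants W f d)
    (a : Fin n →₀ ℕ) : (aeval f (monomial a (1 : ℂ))).IsHomogeneous (Finsupp.weight d a) := by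
  rw [aeval_monomial, map_one, one_mul, Finsupp.prod_fintype _ _ (by simp), Finsupp.weight_apply,
    Finsupp.sum_fintype _ _ (by simp)]
  refine IsHomogeneous.prod _ _ _ fun i _ => ?_
  simpa [mul_comm] using (hf.2.1 i).pow (a i)

theorem IsBasicInvariants.linSubst_aeval (hf : IsBasicInvariants W f d)
    (w : W) (q : MvPolynomial (Fin n) ℂ) :
    linSubst (glMatrix (w : (Fin n → ℂ) ≃ₗ[ℂ] (Fin n → ℂ))) (aeval f q) = aeval f q := by
  have h : aeval f q ∈ invariantsAlg W := by
    rw [← hf.2.2.2]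
    exact ⟨q, rfl⟩
  exact h w w.2

theorem IsBasicInvariants.exists_aeval_eq (hf : IsBasicInvariants W f d)
    {p : MvPolynomial (Fin n) ℂ}
    (hp : ∀ w : W, linSubst (glMatrix (w : (Fin n → ℂ) ≃ₗ[ℂ] (Fin n → ℂ))) p = p) :
    ∃ q : MvPolynomial (Fin n) ℂ, aeval f q = p := by
  have h : p ∈ invariantsAlg W := fun g hg => hp ⟨g, hg⟩
  rw [← hf.2.2.2] at h
  exact h

/-- The monomials in the basic invariants, multiplied by a fixed nonzero homogeneous polynomial,
are linearly independent. -/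
theorem IsBasicInvariants.linearIndependent_mul_aeval_monomial (hf : IsBasicInvariants W f d)
    {J : MvPolynomial (Fin n) ℂ} (hJ : J ≠ 0) :
    LinearIndependent ℂ fun a : Fin n →₀ ℕ => J * aeval f (monomial a (1 : ℂ)) := by
  have h := (basisMonomials (Fin n) ℂ).linearIndependent
  have h2 := h.map' (LinearMap.mulLeft ℂ J ∘ₗ
    (aeval f : MvPolynomial (Fin n) ℂ →ₐ[ℂ] MvPolynomial (Fin n) ℂ).toLinearMap) (by
    rw [LinearMap.ker_eq_bot]
    exact (mul_right_injective₀ hJ).comp hf.2.2.1)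
  rw [coe_basisMonomials] at h2
  exact h2

/-- A homogeneous polynomial in the basic invariants is a combination of monomials of the correct
weight. -/
theorem IsBasicInvariants.homogeneousComponent_mul_aeval_mem_span (hf : IsBasicInvariants W f d)
    {J : MvPolynomial (Fin n) ℂ} {m : ℕ} (hJ : J.IsHomogeneous m) (k : ℕ)
    (q : MvPolynomial (Fin n) ℂ) :
    homogeneousComponent k (J * aeval f q) ∈ Submodule.span ℂ (Set.range
      fun a : {a : Fin n →₀ ℕ // m + Finsupp.weight d a = k} =>
        J * aeval f (monomial a.1 (1 : ℂ))) := by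
  induction q using MvPolynomial.induction_on' with
  | monomial a c =>
    have h1 : J * aeval f (monomial a c) = c • (J * aeval f (monomial a (1 : ℂ))) := by
      rw [← mul_smul_comm, ← map_smul, smul_monomial, smul_eq_mul, mul_one]
    rw [h1, map_smul]
    refine Submodule.smul_mem _ _ ?_
    rw [homogeneousComponent_of_mem (hJ.mul (hf.isHomogeneous_aeval_monomial a))]
    split_ifs with h
    · exact Submodule.subset_span ⟨⟨a, h.symm⟩, rfl⟩
    · exact Submodule.zero_mem _
  | add p q hp hq =>
    rw [map_add, mul_add, map_add]
    exact Submodule.add_mem _ hp hq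

theorem IsBasicInvariants.sum_trace_linSubstHom [Fintype W] (hf : IsBasicInvariants W f d)
    (k : ℕ) :
    ∑ w : W, LinearMap.trace ℂ _
        (linSubstHom k (glMatrix (w : (Fin n → ℂ) ≃ₗ[ℂ] (Fin n → ℂ)))) =
      Fintype.card W * (weightFinset d hf.degree_ne_zero k).card := by
  let b : weightFinset d hf.degree_ne_zero k → homogeneousSubmodule (Fin n) ℂ k := fun a =>
    ⟨aeval f (monomial a.1 1), (mem_weightFinset.1 a.2) ▸ hf.isHomogeneous_aeval_monomial a.1⟩
  have hb : LinearIndependent ℂ b := by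
    refine LinearIndependent.of_comp (Submodule.subtype _) ?_
    have h := hf.linearIndependent_mul_aeval_monomial one_ne_zero
    simp only [one_mul] at h
    exact h.comp (fun a : weightFinset d hf.degree_ne_zero k => a.1) Subtype.val_injective
  have hspan : ∀ u : homogeneousSubmodule (Fin n) ℂ k,
      (∀ w : W, linSubstHom k (glMatrix (w : (Fin n → ℂ) ≃ₗ[ℂ] (Fin n → ℂ))) u = u) →
      u ∈ Submodule.span ℂ (Set.range b) := by
    intro u hu
    obtain ⟨q, hq⟩ := hf.exists_aeval_eq (p := u) fun w => congrArg Subtype.val (hu w)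
    have h1 := hf.homogeneousComponent_mul_aeval_mem_span (isHomogeneous_one (Fin n) ℂ) k q
    rw [one_mul, hq, homogeneousComponent_of_mem u.2, if_pos rfl] at h1
    have h2 : (u : MvPolynomial (Fin n) ℂ) ∈
        (Submodule.span ℂ (Set.range b)).map (Submodule.subtype _) := by
      rw [Submodule.map_span]
      refine Submodule.span_mono ?_ h1
      rintro _ ⟨a, rfl⟩
      exact ⟨_, ⟨⟨a.1, mem_weightFinset.2 (by simpa using a.2)⟩, rfl⟩, by simp [b]⟩
    obtain ⟨v, hv, hvu⟩ := h2
    rwa [← Subtype.ext hvu]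
  have key := sum_trace_comp_eq
    (fun w : W => linSubstHom k (glMatrix (w : (Fin n → ℂ) ≃ₗ[ℂ] (Fin n → ℂ))))
    (fun v w => by rw [linSubstHom_comp, ← glMatrix_mul]; rfl) LinearMap.id b (fun _ => 1) hb
    (fun w a => Subtype.ext (hf.linSubst_aeval w _)) hspan fun _ => (one_smul _ _).symm
  simpa using key

theorem det_one_sub_smul_conj {P Q : Matrix (Fin n) (Fin n) ℂ} (hPQ : P * Q = 1) (l : Fin n → ℂ)
    (t : ℂ) : (1 - t • (P * Matrix.diagonal l * Q)).det = ∏ i, (1 - l i * t) := by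
  have h : 1 - t • (P * Matrix.diagonal l * Q) =
      P * Matrix.diagonal (fun i => 1 - l i * t) * Q := by
    have h1 : Matrix.diagonal (fun i => 1 - l i * t) = 1 - t • Matrix.diagonal l := by
      rw [← Matrix.diagonal_one, ← Matrix.diagonal_smul, Matrix.diagonal_sub]
      simp [mul_comm]
    rw [h1, mul_sub, sub_mul, mul_one, hPQ, mul_smul_comm, smul_mul_assoc]
  rw [h, Matrix.det_mul, Matrix.det_mul, mul_right_comm, ← Matrix.det_mul, hPQ, Matrix.det_one,
    one_mul, Matrix.det_diagonal]

theorem det_one_sub_smul_glMatrix_ne_zero [Finite W] (w : W) {t : ℂ} (ht : ‖t‖ ≠ 1) :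
    (1 - t • glMatrix (w : (Fin n → ℂ) ≃ₗ[ℂ] (Fin n → ℂ))).det ≠ 0 := by
  obtain ⟨P, Q, l, hPQ, -, hG, hl, -⟩ := exists_diagonal_of_isOfFinOrder
    (w : (Fin n → ℂ) ≃ₗ[ℂ] (Fin n → ℂ)) (Submonoid.isOfFinOrder_coe.2 (isOfFinOrder_of_finite w))
  rw [hG, det_one_sub_smul_conj hPQ, Finset.prod_ne_zero_iff]
  intro i _ h
  apply ht
  have := congrArg norm (sub_eq_zero.1 h)
  rwa [norm_one, norm_mul, hl, one_mul, eq_comm] at this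

/-- Linear relations between the traces on homogeneous polynomials amount to relations between
the inverses of the characteristic polynomials. -/
theorem forall_sum_trace_linSubstHom_iff [Fintype W] (hd : ∀ i, d i ≠ 0) (c : W → ℂ)
    (B : Polynomial ℂ) :
    (∀ k, ∑ w : W, c w * LinearMap.trace ℂ _
        (linSubstHom k (glMatrix (w : (Fin n → ℂ) ≃ₗ[ℂ] (Fin n → ℂ)))) =
      PowerSeries.coeff k ((B : PowerSeries ℂ) * weightSeries d hd 1)) ↔
    ∀ t : ℂ, t ≠ 0 → ‖t‖ ≠ 1 →
      ∑ w : W, c w / (1 - t • glMatrix (w : (Fin n → ℂ) ≃ₗ[ℂ] (Fin n → ℂ))).det =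
        B.eval t / ∏ i, (1 - t ^ d i) := by
  have hex := fun w : W => exists_diagonal_of_isOfFinOrder
    (w : (Fin n → ℂ) ≃ₗ[ℂ] (Fin n → ℂ)) (Submonoid.isOfFinOrder_coe.2 (isOfFinOrder_of_finite w))
  choose P Q l hPQ hQP hG hl _ using hex
  have key := sum_mul_inv_eq_iff (fun w : W => Polynomial.C (c w))
    (fun w => ∏ i, (1 - Polynomial.C (l w i) * Polynomial.X ^ (1 : Fin n → ℕ) i)) B
    (∏ i, (1 - Polynomial.C ((1 : Fin n → ℂ) i) * Polynomial.X ^ d i))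
    (fun w => weightSeries 1 one_weight_ne_zero (l w)) (weightSeries d hd 1)
    (fun w => weightSeries_mul _ _ _) (weightSeries_mul _ _ _) {t | t ≠ 0 ∧ ‖t‖ ≠ 1} ?_ ?_ ?_
  · rw [PowerSeries.ext_iff] at key
    convert key using 1
    · refine forall_congr' fun k => ?_
      simp only [hG, trace_linSubstHom_conj k (hQP _), trace_linSubstHom_diagonal, map_sum,
        Polynomial.coe_C, PowerSeries.coeff_C_mul, weightSeries, PowerSeries.coeff_mk]
    · simp [hG, det_one_sub_smul_conj (hPQ _), Polynomial.eval_prod]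
  · refine Set.Infinite.mono (s := Set.range fun k : ℕ => ((k + 2 : ℕ) : ℂ)) ?_
      (Set.infinite_range_of_injective fun a b h => by simpa using h)
    rintro _ ⟨k, rfl⟩
    refine ⟨Nat.cast_ne_zero.2 (by simp), ?_⟩
    rw [Complex.norm_natCast]
    exact_mod_cast (by simp : k + 2 ≠ 1)
  · rintro t ⟨-, ht⟩ w
    have := det_one_sub_smul_glMatrix_ne_zero w ht
    rw [hG, det_one_sub_smul_conj (hPQ w)] at this
    simpa [Polynomial.eval_prod] using this
  · rintro t ⟨-, ht⟩
    rw [Polynomial.eval_prod, Finset.prod_ne_zero_iff]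
    intro i _ h
    apply ht
    simp only [Pi.one_apply, map_one, one_mul, Polynomial.eval_sub, Polynomial.eval_one,
      Polynomial.eval_pow, Polynomial.eval_X, sub_eq_zero] at h
    exact Complex.norm_eq_one_of_pow_eq_one h.symm (hd i)

theorem coeff_weightSeries_one (hd : ∀ i, d i ≠ 0) (k : ℕ) :
    PowerSeries.coeff k (weightSeries d hd 1) = (weightFinset d hd k).card := by
  simp [weightSeries]

/-- **Molien's formula**. -/
theorem IsBasicInvariants.sum_inv_det [Fintype W] (hf : IsBasicInvariants W f d) {t : ℂ}
    (ht0 : t ≠ 0) (ht : ‖t‖ ≠ 1) :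
    ∑ w : W, 1 / (1 - t • glMatrix (w : (Fin n → ℂ) ≃ₗ[ℂ] (Fin n → ℂ))).det =
      Fintype.card W / ∏ i, (1 - t ^ d i) := by
  have h := (forall_sum_trace_linSubstHom_iff hf.degree_ne_zero (fun _ : W => 1)
    (Polynomial.C (Fintype.card W : ℂ))).1 (fun k => by
      simp only [one_mul]
      rw [hf.sum_trace_linSubstHom, Polynomial.coe_C, PowerSeries.coeff_C_mul,
        coeff_weightSeries_one]) t ht0 ht
  rwa [Polynomial.eval_C] at h

theorem IsBasicInvariants.sum_det_div_det [Fintype W] (hf : IsBasicInvariants W f d) {t : ℂ}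
    (ht0 : t ≠ 0) (ht : ‖t‖ ≠ 1) :
    ∑ w : W, (glMatrix (w : (Fin n → ℂ) ≃ₗ[ℂ] (Fin n → ℂ))).det /
        (1 - t • glMatrix (w : (Fin n → ℂ) ≃ₗ[ℂ] (Fin n → ℂ))).det =
      Fintype.card W * t ^ (∑ i, (d i - 1)) / ∏ i, (1 - t ^ d i) := by
  have hti : ‖t⁻¹‖ ≠ 1 := by simpa using ht
  have hw : ∀ w : W, (glMatrix (w : (Fin n → ℂ) ≃ₗ[ℂ] (Fin n → ℂ))).det /
        (1 - t • glMatrix (w : (Fin n → ℂ) ≃ₗ[ℂ] (Fin n → ℂ))).det =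
      (-t⁻¹) ^ n * (1 / (1 - t⁻¹ • glMatrix ((w⁻¹ : W) : (Fin n → ℂ) ≃ₗ[ℂ] (Fin n → ℂ))).det) := by
    intro w
    have h1 : glMatrix ((w⁻¹ : W) : (Fin n → ℂ) ≃ₗ[ℂ] (Fin n → ℂ)) *
        glMatrix (w : (Fin n → ℂ) ≃ₗ[ℂ] (Fin n → ℂ)) = 1 := by
      rw [← glMatrix_mul, ← Subgroup.coe_mul, inv_mul_cancel, Subgroup.coe_one, glMatrix_one]
    have h2 : (1 - t⁻¹ • glMatrix ((w⁻¹ : W) : (Fin n → ℂ) ≃ₗ[ℂ] (Fin n → ℂ))) *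
        glMatrix (w : (Fin n → ℂ) ≃ₗ[ℂ] (Fin n → ℂ)) =
        (-t⁻¹) • (1 - t • glMatrix (w : (Fin n → ℂ) ≃ₗ[ℂ] (Fin n → ℂ))) := by
      rw [sub_mul, smul_mul_assoc, h1, smul_sub, smul_smul, neg_mul, inv_mul_cancel₀ ht0, one_mul,
        neg_smul, neg_smul, one_smul]
      abel
    have h3 := congrArg Matrix.det h2
    rw [Matrix.det_mul, Matrix.det_smul, Fintype.card_fin] at h3
    rw [mul_one_div, div_eq_div_iff (det_one_sub_smul_glMatrix_ne_zero w ht)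
      (det_one_sub_smul_glMatrix_ne_zero _ hti), ← h3, mul_comm]
  simp only [hw]
  rw [← Finset.mul_sum]
  have h4 := hf.sum_inv_det (inv_ne_zero ht0) hti
  rw [← Equiv.sum_comp (Equiv.inv W)] at h4
  simp only [Equiv.inv_apply] at h4
  have h5 : (-t⁻¹) ^ n = ∏ _i : Fin n, (-t⁻¹) := by simp
  rw [h4, ← Finset.prod_pow_eq_pow_sum, mul_div_assoc, div_eq_mul_inv, mul_left_comm,
    ← div_eq_mul_inv, h5, ← Finset.prod_div_distrib, ← Finset.prod_div_distrib]
  congr 1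
  refine Finset.prod_congr rfl fun i _ => ?_
  have hd := hf.degree_ne_zero i
  have hne : ∀ {u : ℂ}, ‖u‖ ≠ 1 → 1 - u ^ d i ≠ 0 := fun hu h =>
    hu (Complex.norm_eq_one_of_pow_eq_one (sub_eq_zero.1 h).symm hd)
  rw [div_eq_div_iff (hne hti) (hne ht)]
  obtain ⟨m, hm⟩ := Nat.exists_eq_succ_of_ne_zero hd
  rw [hm, Nat.succ_eq_add_one, Nat.add_sub_cancel, inv_pow]
  have ht1 : t ^ (m + 1) ≠ 0 := pow_ne_zero _ ht0
  field_simp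
  ring

theorem IsBasicInvariants.sum_det_mul_trace_linSubstHom [Fintype W] (hf : IsBasicInvariants W f d)
    (k : ℕ) :
    ∑ w : W, (glMatrix (w : (Fin n → ℂ) ≃ₗ[ℂ] (Fin n → ℂ))).det * LinearMap.trace ℂ _
        (linSubstHom k (glMatrix (w : (Fin n → ℂ) ≃ₗ[ℂ] (Fin n → ℂ)))) =
      Fintype.card W * if ∑ i, (d i - 1) ≤ k then
        ((weightFinset d hf.degree_ne_zero (k - ∑ i, (d i - 1))).card : ℂ) else 0 := by
  rw [(forall_sum_trace_linSubstHom_iff hf.degree_ne_zero (fun w : W =>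
      (glMatrix (w : (Fin n → ℂ) ≃ₗ[ℂ] (Fin n → ℂ))).det)
    (Polynomial.C (Fintype.card W : ℂ) * Polynomial.X ^ (∑ i, (d i - 1)))).2 ?_ k]
  · rw [Polynomial.coe_mul, Polynomial.coe_C, Polynomial.coe_pow, Polynomial.coe_X, mul_assoc,
      PowerSeries.coeff_C_mul, PowerSeries.coeff_X_pow_mul', coeff_weightSeries_one]
  · intro t ht0 ht
    rw [hf.sum_det_div_det ht0 ht]
    simp

theorem pderiv_linSubst (M : Matrix (Fin n) (Fin n) ℂ) (k : Fin n) (p : MvPolynomial (Fin n) ℂ) :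
    pderiv k (linSubst M p) = ∑ j, linSubst M (pderiv j p) * C (M j k) := by
  induction p using MvPolynomial.induction_on with
  | C a => simp [linSubst]
  | add p q hp hq => simp only [map_add, hp, hq, add_mul, Finset.sum_add_distrib]
  | mul_X p i hp =>
    have h : pderiv k (linSubst M (X i)) = C (M i k) := by
      rw [linSubst_X, map_sum, Finset.sum_eq_single k]
      · rw [pderiv_C_mul, pderiv_X_self, mul_one]
      · intro j _ hj
        rw [pderiv_C_mul, pderiv_X_of_ne hj, mul_zero]
      · simp
    have h2 : ∑ j, linSubst M (p * pderiv j (X i)) * C (M j k) = linSubst M p * C (M i k) := by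
      rw [Finset.sum_eq_single i]
      · rw [pderiv_X_self, mul_one]
      · intro j _ hj
        rw [pderiv_X_of_ne hj.symm, mul_zero, map_zero, zero_mul]
      · simp
    have h3 : ∑ j, linSubst M (pderiv j p * X i) * C (M j k) =
        (∑ j, linSubst M (pderiv j p) * C (M j k)) * linSubst M (X i) := by
      rw [Finset.sum_mul]
      exact Finset.sum_congr rfl fun j _ => by rw [map_mul, mul_right_comm]
    rw [map_mul, pderiv_mul, h, hp, ← h2, ← h3, ← Finset.sum_add_distrib]
    refine Finset.sum_congr rfl fun j _ => ?_
    rw [pderiv_mul, map_add, add_mul]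

/-- The Jacobian matrix of a family of polynomials. -/
noncomputable def jacobian (f : Fin n → MvPolynomial (Fin n) ℂ) :
    Matrix (Fin n) (Fin n) (MvPolynomial (Fin n) ℂ) :=
  Matrix.of fun i j => pderiv j (f i)

theorem IsBasicInvariants.linSubst_basic (hf : IsBasicInvariants W f d) (w : W) (i : Fin n) :
    linSubst (glMatrix (w : (Fin n → ℂ) ≃ₗ[ℂ] (Fin n → ℂ))) (f i) = f i := by
  simpa using hf.linSubst_aeval w (X i)

theorem IsBasicInvariants.map_jacobian_mul (hf : IsBasicInvariants W f d) (w : W) :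
    (jacobian f).map (linSubst (glMatrix (w : (Fin n → ℂ) ≃ₗ[ℂ] (Fin n → ℂ)))) *
      (glMatrix (w : (Fin n → ℂ) ≃ₗ[ℂ] (Fin n → ℂ))).map C = jacobian f := by
  refine Matrix.ext fun i k => ?_
  have h := pderiv_linSubst (glMatrix (w : (Fin n → ℂ) ≃ₗ[ℂ] (Fin n → ℂ))) k (f i)
  rw [hf.linSubst_basic] at h
  simpa [Matrix.mul_apply, jacobian] using h.symm

theorem IsBasicInvariants.det_smul_linSubst_det_jacobian (hf : IsBasicInvariants W f d) (w : W) :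
    (glMatrix (w : (Fin n → ℂ) ≃ₗ[ℂ] (Fin n → ℂ))).det •
      linSubst (glMatrix (w : (Fin n → ℂ) ≃ₗ[ℂ] (Fin n → ℂ))) (jacobian f).det =
        (jacobian f).det := by
  conv_rhs => rw [← hf.map_jacobian_mul w, Matrix.det_mul]
  rw [AlgHom.map_det, smul_eq_C_mul, RingHom.map_det, mul_comm]
  rfl

theorem IsBasicInvariants.isHomogeneous_det_jacobian (hf : IsBasicInvariants W f d) :
    (jacobian f).det.IsHomogeneous (∑ i, (d i - 1)) := by
  rw [← Matrix.det_transpose, Matrix.det_apply]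
  refine IsHomogeneous.sum _ _ _ fun σ _ => ?_
  have h : (∏ i, (jacobian f).transpose (σ i) i).IsHomogeneous (∑ i, (d i - 1)) :=
    IsHomogeneous.prod _ _ _ fun i _ => (hf.2.1 i).pderiv
  rcases Int.units_eq_one_or (Equiv.Perm.sign σ) with hσ | hσ
  · rwa [hσ, one_smul]
  · rw [hσ, Units.neg_smul, one_smul]
    exact h.neg

/-- In characteristic zero, a derivation killing the coefficients of a nonzero polynomial kills its
roots. -/
theorem Derivation.eq_zero_of_eval_eq_zero {S : Type*} [CommRing S] [IsDomain S] [CharZero S]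
    [Algebra ℂ S] (D : Derivation ℂ S S) (x : S) (p : Polynomial S) (hp0 : p ≠ 0)
    (hD : ∀ k, D (p.coeff k) = 0) (hx : p.eval x = 0) : D x = 0 := by
  induction hN : p.natDegree using Nat.strong_induction_on generalizing p with
  | _ N ih =>
    by_contra hDx
    have h1 : D (p.eval x) = p.derivative.eval x * D x := by
      rw [Polynomial.eval_eq_sum, Polynomial.derivative_eval, Polynomial.sum, Polynomial.sum,
        map_sum, Finset.sum_mul]
      refine Finset.sum_congr rfl fun k _ => ?_
      rw [Derivation.leibniz, Derivation.leibniz_pow, hD, smul_zero, add_zero]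
      simp only [smul_eq_mul, nsmul_eq_mul]
      ring
    rw [hx, map_zero, eq_comm, mul_eq_zero, or_iff_left hDx] at h1
    have hdeg : p.natDegree ≠ 0 := by
      intro h
      rw [Polynomial.eq_C_of_natDegree_eq_zero h, Polynomial.eval_C] at hx
      apply hp0
      rw [Polynomial.eq_C_of_natDegree_eq_zero h, hx, Polynomial.C_0]
    have hder : p.derivative ≠ 0 := fun h => hdeg (Polynomial.derivative_eq_zero.1 h)
    refine hDx (ih _ (hN ▸ Polynomial.natDegree_derivative_lt hdeg) _ hder (fun k => ?_) h1 rfl)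
    rw [Polynomial.coeff_derivative, Derivation.leibniz, hD, smul_zero, add_zero]
    have : D ((k : S) + 1) = 0 := by simp
    rw [this, smul_zero]

theorem IsBasicInvariants.det_jacobian_ne_zero [Fintype W] (hf : IsBasicInvariants W f d) :
    (jacobian f).det ≠ 0 := by
  intro h0
  obtain ⟨v, hv0, hv⟩ := Matrix.exists_mulVec_eq_zero_iff.2 h0
  let D : Derivation ℂ (MvPolynomial (Fin n) ℂ) (MvPolynomial (Fin n) ℂ) := ∑ j, v j • pderiv j
  have hD : ∀ p, D p = ∑ j, v j * pderiv j p := by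
    intro p
    have h := congrFun (map_sum (Derivation.coeFnAddMonoidHom (R := ℂ) (A := MvPolynomial (Fin n) ℂ)
      (M := MvPolynomial (Fin n) ℂ)) (fun j => v j • pderiv j) Finset.univ) p
    rw [Finset.sum_apply] at h
    exact h
  have hDf : ∀ i, D (f i) = 0 := by
    intro i
    have := congrFun hv i
    simp only [Matrix.mulVec, dotProduct, jacobian, Matrix.of_apply] at this
    rw [hD]
    refine Eq.trans ?_ this
    exact Finset.sum_congr rfl fun j _ => mul_comm _ _
  have hDinv : ∀ p, (∀ w : W, linSubst (glMatrix (w : (Fin n → ℂ) ≃ₗ[ℂ] (Fin n → ℂ))) p = p) →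
      D p = 0 := by
    intro p hp
    obtain ⟨q, rfl⟩ := hf.exists_aeval_eq hp
    have h1 : Set.EqOn D (0 : Derivation ℂ _ _) (Set.range f) := by
      rintro _ ⟨i, rfl⟩
      simpa using hDf i
    refine Derivation.eqOn_adjoin h1 ?_
    rw [Algebra.adjoin_range_eq_range_aeval]
    exact ⟨q, rfl⟩
  apply hv0
  funext j
  have hDj : D (X j) = v j := by
    rw [hD, Finset.sum_eq_single j] <;> simp +contextual [pderiv_X, eq_comm]
  rw [Pi.zero_apply, ← hDj]
  let p : Polynomial (MvPolynomial (Fin n) ℂ) := ∏ w : W, (Polynomial.X -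
    Polynomial.C (linSubst (glMatrix (w : (Fin n → ℂ) ≃ₗ[ℂ] (Fin n → ℂ))) (X j)))
  have hp : p.Monic := Polynomial.monic_prod_of_monic _ _ fun w _ => Polynomial.monic_X_sub_C _
  refine D.eq_zero_of_eval_eq_zero _ p hp.ne_zero (fun k => hDinv _ fun v => ?_) ?_
  · have h1 : p.map (linSubst (glMatrix (v : (Fin n → ℂ) ≃ₗ[ℂ] (Fin n → ℂ)))).toRingHom = p := by
      rw [Polynomial.map_prod]
      refine Fintype.prod_equiv (Equiv.mulRight v) _ _ fun w => ?_
      rw [Polynomial.map_sub, Polynomial.map_X, Polynomial.map_C]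
      have h2 := DFunLike.congr_fun (linSubst_comp (glMatrix (v : (Fin n → ℂ) ≃ₗ[ℂ] (Fin n → ℂ)))
        (glMatrix (w : (Fin n → ℂ) ≃ₗ[ℂ] (Fin n → ℂ)))) (X j)
      rw [← glMatrix_mul] at h2
      exact congrArg (fun z => Polynomial.X - Polynomial.C z) h2
    conv_rhs => rw [← h1, Polynomial.coeff_map]
    rfl
  · rw [Polynomial.eval_prod]
    refine Finset.prod_eq_zero (Finset.mem_univ 1) ?_
    rw [Subgroup.coe_one, glMatrix_one, linSubst_one]
    simp

theorem homogeneousComponent_linSubst (M : Matrix (Fin n) (Fin n) ℂ) (k : ℕ)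
    (p : MvPolynomial (Fin n) ℂ) :
    homogeneousComponent k (linSubst M p) = linSubst M (homogeneousComponent k p) := by
  conv_lhs => rw [← sum_homogeneousComponent p, map_sum, map_sum]
  have h : ∀ i, homogeneousComponent k (linSubst M (homogeneousComponent i p)) =
      if k = i then linSubst M (homogeneousComponent i p) else 0 := fun i =>
    homogeneousComponent_of_mem (linSubst_isHomogeneous M (homogeneousComponent_isHomogeneous i p))
  simp only [h, Finset.sum_ite_eq]
  split_ifs with hk
  · rfl
  · rw [homogeneousComponent_eq_zero, map_zero]
    rw [Finset.mem_range] at hk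
    omega

/-- The polynomials on which `W` acts through the inverse of the determinant are the multiples of
the Jacobian by invariants. -/
theorem IsBasicInvariants.exists_eq_det_jacobian_mul [Fintype W] (hf : IsBasicInvariants W f d)
    {g : MvPolynomial (Fin n) ℂ}
    (hg : ∀ w : W, (glMatrix (w : (Fin n → ℂ) ≃ₗ[ℂ] (Fin n → ℂ))).det •
      linSubst (glMatrix (w : (Fin n → ℂ) ≃ₗ[ℂ] (Fin n → ℂ))) g = g) :
    ∃ q : MvPolynomial (Fin n) ℂ, (jacobian f).det * aeval f q = g := by
  let m := ∑ i, (d i - 1)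
  let R : Submodule ℂ (MvPolynomial (Fin n) ℂ) :=
    LinearMap.range (LinearMap.mulLeft ℂ (jacobian f).det ∘ₗ
      (aeval f : MvPolynomial (Fin n) ℂ →ₐ[ℂ] MvPolynomial (Fin n) ℂ).toLinearMap)
  suffices h : ∀ k, homogeneousComponent k g ∈ R by
    have h1 : g ∈ R := by
      rw [← sum_homogeneousComponent g]
      exact Submodule.sum_mem _ fun k _ => h k
    exact h1
  intro k
  let T : Finset (Fin n →₀ ℕ) := if m ≤ k then weightFinset d hf.degree_ne_zero (k - m) else ∅
  have hT : ∀ a ∈ T, m + Finsupp.weight d a = k := by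
    intro a ha
    by_cases hmk : m ≤ k
    · simp only [T, if_pos hmk, mem_weightFinset] at ha
      omega
    · simp [T, hmk] at ha
  let b : T → homogeneousSubmodule (Fin n) ℂ k := fun a =>
    ⟨(jacobian f).det * aeval f (monomial a.1 1), (hT a.1 a.2) ▸
      hf.isHomogeneous_det_jacobian.mul (hf.isHomogeneous_aeval_monomial a.1)⟩
  have hb : LinearIndependent ℂ b := by
    refine LinearIndependent.of_comp (Submodule.subtype _) ?_
    exact (hf.linearIndependent_mul_aeval_monomial hf.det_jacobian_ne_zero).comp
      (fun a : T => a.1) Subtype.val_injective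
  let ρ : W → Module.End ℂ (homogeneousSubmodule (Fin n) ℂ k) := fun w =>
    (glMatrix (w : (Fin n → ℂ) ≃ₗ[ℂ] (Fin n → ℂ))).det •
      linSubstHom k (glMatrix (w : (Fin n → ℂ) ≃ₗ[ℂ] (Fin n → ℂ)))
  have hmul : ∀ v w, ρ v ∘ₗ ρ w = ρ (w * v) := by
    intro v w
    simp only [ρ, LinearMap.smul_comp, LinearMap.comp_smul, linSubstHom_comp, ← glMatrix_mul,
      smul_smul, ← Matrix.det_mul, Subgroup.coe_mul]
  have hρ : ∀ w j, ρ w (b j) = b j := by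
    intro w a
    apply Subtype.ext
    simp only [ρ, b, LinearMap.smul_apply, SetLike.val_smul, coe_linSubstHom, map_mul,
      hf.linSubst_aeval]
    rw [← smul_mul_assoc, hf.det_smul_linSubst_det_jacobian]
  have htr : ∑ w, LinearMap.trace ℂ _ (ρ w) = Fintype.card W * Fintype.card T := by
    simp only [ρ, map_smul, smul_eq_mul, hf.sum_det_mul_trace_linSubstHom, Fintype.card_coe, T]
    split_ifs <;> simp [m]
  have hu : ∀ w, ρ w ⟨homogeneousComponent k g, homogeneousComponent_isHomogeneous k g⟩ =
      ⟨homogeneousComponent k g, homogeneousComponent_isHomogeneous k g⟩ := by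
    intro w
    apply Subtype.ext
    simp only [ρ, LinearMap.smul_apply, SetLike.val_smul, coe_linSubstHom]
    rw [← homogeneousComponent_linSubst, ← map_smul, hg]
  have key := Submodule.mem_map_of_mem (f := Submodule.subtype _)
    (mem_span_of_sum_trace_eq ρ hmul b hb hρ htr hu)
  rw [Submodule.map_span] at key
  refine Submodule.span_le.2 ?_ key
  rintro _ ⟨_, ⟨a, rfl⟩, rfl⟩
  exact ⟨monomial a.1 1, rfl⟩

open scoped TensorProduct

/-- The algebra of polynomial differential forms on `Fin n → ℂ`. -/
abbrev PolyForm (n : ℕ) : Type :=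
  MvPolynomial (Fin n) ℂ ⊗[ℂ] ExteriorAlgebra ℂ (Fin n → ℂ)

namespace PolyForm

/-- The differential one-form with given coefficients. -/
noncomputable def oneForm :
    (Fin n → MvPolynomial (Fin n) ℂ) →ₗ[MvPolynomial (Fin n) ℂ] PolyForm n :=
  Fintype.linearCombination (MvPolynomial (Fin n) ℂ) fun j =>
    (1 : MvPolynomial (Fin n) ℂ) ⊗ₜ ExteriorAlgebra.ι ℂ (Pi.single j 1 : Fin n → ℂ)

theorem oneForm_apply (v : Fin n → MvPolynomial (Fin n) ℂ) :
    oneForm v = ∑ j, v j ⊗ₜ[ℂ] ExteriorAlgebra.ι ℂ (Pi.single j 1 : Fin n → ℂ) := by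
  simp [oneForm, Fintype.linearCombination_apply, TensorProduct.smul_tmul']

theorem oneForm_single (j : Fin n) (s : MvPolynomial (Fin n) ℂ) :
    oneForm (Pi.single j s) = s ⊗ₜ[ℂ] ExteriorAlgebra.ι ℂ (Pi.single j 1 : Fin n → ℂ) := by
  rw [oneForm, Fintype.linearCombination_apply_single, TensorProduct.smul_tmul', smul_eq_mul,
    mul_one]

theorem oneForm_mul_self (v : Fin n → MvPolynomial (Fin n) ℂ) : oneForm v * oneForm v = 0 := by
  rw [oneForm_apply, Finset.sum_mul_sum]
  simp only [Algebra.TensorProduct.tmul_mul_tmul]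
  have hι : ∀ i j : Fin n, ExteriorAlgebra.ι ℂ (Pi.single i 1 : Fin n → ℂ) *
      ExteriorAlgebra.ι ℂ (Pi.single j 1 : Fin n → ℂ) =
      - (ExteriorAlgebra.ι ℂ (Pi.single j 1 : Fin n → ℂ) *
      ExteriorAlgebra.ι ℂ (Pi.single i 1 : Fin n → ℂ)) := fun i j =>
    eq_neg_of_add_eq_zero_left (ExteriorAlgebra.ι_add_mul_swap _ _)
  suffices h : ∀ x : PolyForm n, x = -x → x = 0 by
    refine h _ ?_
    conv_lhs => rw [Finset.sum_comm]
    rw [← Finset.sum_neg_distrib]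
    refine Finset.sum_congr rfl fun i _ => ?_
    rw [← Finset.sum_neg_distrib]
    refine Finset.sum_congr rfl fun j _ => ?_
    rw [hι, TensorProduct.tmul_neg, mul_comm (v j)]
  intro x hx
  have h2 : (2 : ℂ) • x = 0 := by
    rw [two_smul]
    exact add_eq_zero_iff_eq_neg.2 hx
  exact (smul_eq_zero.1 h2).resolve_left two_ne_zero

/-- The algebra map from the exterior algebra of the module of one-forms to the algebra of
differential forms. -/
noncomputable def ofExterior :
    ExteriorAlgebra (MvPolynomial (Fin n) ℂ) (Fin n → MvPolynomial (Fin n) ℂ)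
      →ₐ[MvPolynomial (Fin n) ℂ] PolyForm n :=
  ExteriorAlgebra.lift _ ⟨oneForm, oneForm_mul_self⟩

theorem ofExterior_ι (v : Fin n → MvPolynomial (Fin n) ℂ) :
    ofExterior (ExteriorAlgebra.ι _ v) = oneForm v :=
  ExteriorAlgebra.lift_ι_apply _ _ _ v

theorem oneForm_linearCombination_mul_self (M : Matrix (Fin n) (Fin n) (MvPolynomial (Fin n) ℂ))
    (v : Fin n → ℂ) :
    (oneForm.restrictScalars ℂ ∘ₗ Fintype.linearCombination ℂ M.row) v *
      (oneForm.restrictScalars ℂ ∘ₗ Fintype.linearCombination ℂ M.row) v = 0 :=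
  oneForm_mul_self _

/-- The endomorphism of the algebra of differential forms, linear over polynomials, which acts on
one-forms through a given matrix. -/
noncomputable def ofMatrix (M : Matrix (Fin n) (Fin n) (MvPolynomial (Fin n) ℂ)) :
    PolyForm n →ₐ[MvPolynomial (Fin n) ℂ] PolyForm n :=
  Algebra.TensorProduct.lift (Algebra.ofId _ _)
    (ExteriorAlgebra.lift ℂ ⟨oneForm.restrictScalars ℂ ∘ₗ Fintype.linearCombination ℂ M.row,
      oneForm_linearCombination_mul_self M⟩) fun s _ => by
      rw [Algebra.ofId_apply]
      exact Algebra.commutes s _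

theorem ofMatrix_tmul_ι (M : Matrix (Fin n) (Fin n) (MvPolynomial (Fin n) ℂ))
    (s : MvPolynomial (Fin n) ℂ) (v : Fin n → ℂ) :
    ofMatrix M (s ⊗ₜ ExteriorAlgebra.ι ℂ v) = s • oneForm (∑ i, v i • M.row i) := by
  rw [ofMatrix, Algebra.TensorProduct.lift_tmul, Algebra.ofId_apply, ← Algebra.smul_def,
    ExteriorAlgebra.lift_ι_apply, LinearMap.comp_apply, Fintype.linearCombination_apply]
  rfl

theorem ofMatrix_oneForm (M : Matrix (Fin n) (Fin n) (MvPolynomial (Fin n) ℂ))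
    (v : Fin n → MvPolynomial (Fin n) ℂ) :
    ofMatrix M (oneForm v) = oneForm (Matrix.vecMul v M) := by
  rw [oneForm_apply, map_sum, Matrix.vecMul_eq_sum, map_sum]
  refine Finset.sum_congr rfl fun i _ => ?_
  rw [ofMatrix_tmul_ι, map_smul, Finset.sum_eq_single i] <;>
    simp +contextual [Matrix.row]

theorem algHom_ext_oneForm {A : Type*} [Ring A] [Algebra (MvPolynomial (Fin n) ℂ) A]
   [Algebra ℂ A] [IsScalarTower ℂ (MvPolynomial (Fin n) ℂ) A]
    {φ ψ : PolyForm n →ₐ[MvPolynomial (Fin n) ℂ] A} (h : ∀ v, φ (oneForm v) = ψ (oneForm v)) :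
    φ = ψ := by
  refine Algebra.TensorProduct.ext (by ext) ?_
  refine ExteriorAlgebra.hom_ext ?_
  refine LinearMap.pi_ext' fun i => ?_
  ext
  simpa [oneForm_single] using h (Pi.single i 1)

theorem ofMatrix_comp (M N : Matrix (Fin n) (Fin n) (MvPolynomial (Fin n) ℂ)) :
    (ofMatrix M).comp (ofMatrix N) = ofMatrix (N * M) :=
  algHom_ext_oneForm fun v => by
    simp [ofMatrix_oneForm, Matrix.vecMul_vecMul]

theorem ofMatrix_smul_one_extBasis (c s : MvPolynomial (Fin n) ℂ) (I : Finset (Fin n)) :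
    ofMatrix (c • 1) (s ⊗ₜ extBasis n I) = (c ^ I.card * s) ⊗ₜ extBasis n I := by
  obtain ⟨L, hL, rfl, h⟩ := exists_extBasis_eq_prod I
  rw [h, List.toFinset_card_of_nodup hL]
  clear h hL
  induction L generalizing s with
  | nil =>
    simpa using AlgHom.commutes (ofMatrix (c • 1)) s
  | cons i L ih =>
    have h1 : ∀ t : MvPolynomial (Fin n) ℂ, (t ⊗ₜ[ℂ] ((i :: L).map fun i =>
        ExteriorAlgebra.ι ℂ (Pi.single i 1 : Fin n → ℂ)).prod : PolyForm n) =
        (1 ⊗ₜ ExteriorAlgebra.ι ℂ (Pi.single i 1 : Fin n → ℂ)) * (t ⊗ₜ[ℂ] (L.map fun i =>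
        ExteriorAlgebra.ι ℂ (Pi.single i 1 : Fin n → ℂ)).prod) := fun t => by
      rw [List.map_cons, List.prod_cons, Algebra.TensorProduct.tmul_mul_tmul, one_mul]
    have h2 : ofMatrix (c • 1) ((1 : MvPolynomial (Fin n) ℂ) ⊗ₜ
        ExteriorAlgebra.ι ℂ (Pi.single i 1 : Fin n → ℂ)) =
        c • (1 ⊗ₜ[ℂ] ExteriorAlgebra.ι ℂ (Pi.single i 1 : Fin n → ℂ) : PolyForm n) := by
      rw [← oneForm_single, ofMatrix_oneForm, Matrix.vecMul_smul, Matrix.vecMul_one, map_smul]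
    rw [h1, map_mul, ih, h1, h2, smul_mul_assoc, ← mul_smul_comm, TensorProduct.smul_tmul',
      List.length_cons, smul_eq_mul, pow_succ', mul_assoc]

end PolyForm

/-- The alternating maps of all degrees which are the determinant in the top degree and vanish in
all other degrees. -/
noncomputable def topDet (n : ℕ) (R : Type*) [CommRing R] (k : ℕ) : (Fin n → R) [⋀^Fin k]→ₗ[R] R :=
  Function.update (β := fun k => (Fin n → R) [⋀^Fin k]→ₗ[R] R) (fun _ => 0) n
    Matrix.detRowAlternating k

theorem topDet_self (R : Type*) [CommRing R] : topDet n R n = Matrix.detRowAlternating :=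
  Function.update_self (β := fun k => (Fin n → R) [⋀^Fin k]→ₗ[R] R) _ _ _

theorem topDet_of_ne (R : Type*) [CommRing R] {k : ℕ} (h : k ≠ n) : topDet n R k = 0 :=
  Function.update_of_ne (β := fun k => (Fin n → R) [⋀^Fin k]→ₗ[R] R) h _ _

/-- The top coefficient of an element of the exterior algebra. -/
noncomputable def topCoeff (n : ℕ) : ExteriorAlgebra ℂ (Fin n → ℂ) →ₗ[ℂ] ℂ :=
  ExteriorAlgebra.liftAlternating (topDet n ℂ)

theorem topCoeff_ιMulti (k : ℕ) (v : Fin k → Fin n → ℂ) :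
    topCoeff n (ExteriorAlgebra.ιMulti ℂ k v) = topDet n ℂ k v :=
  ExteriorAlgebra.liftAlternating_apply_ιMulti _ _

theorem topCoeff_extBasis_of_ne {s : Finset (Fin n)} (hs : s ≠ Finset.univ) :
    topCoeff n (extBasis n s) = 0 := by
  rw [extBasis, ExteriorAlgebra.basis_apply_ofCard (n := s.card) _ rfl,
    ExteriorAlgebra.ιMulti_family, topCoeff_ιMulti, topDet_of_ne]
  · rfl
  · intro h
    exact hs (Finset.card_eq_iff_eq_univ _ |>.1 (h.trans (Fintype.card_fin n).symm))

theorem topCoeff_extBasis_univ_ne_zero : topCoeff n (extBasis n Finset.univ) ≠ 0 := by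
  intro h0
  have h : topCoeff n = 0 := by
    refine (extBasis n).ext fun s => ?_
    by_cases hs : s = Finset.univ
    · rw [hs, h0, LinearMap.zero_apply]
    · rw [topCoeff_extBasis_of_ne hs, LinearMap.zero_apply]
  have h1 : topCoeff n (ExteriorAlgebra.ιMulti ℂ n (1 : Matrix (Fin n) (Fin n) ℂ).row) = 1 := by
    rw [topCoeff_ιMulti, topDet_self]
    exact Matrix.det_one
  rw [h, LinearMap.zero_apply] at h1
  exact zero_ne_one h1

theorem extBasis_mul_of_disjoint {s t : Finset (Fin n)} (h : Disjoint s t) :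
    ∃ ε : ℤˣ, extBasis n s * extBasis n t = ε • extBasis n (s ∪ t) := by
  let s' : Set.powersetCard (Fin n) s.card := Set.powersetCard.ofCard rfl
  let t' : Set.powersetCard (Fin n) t.card := Set.powersetCard.ofCard rfl
  have h' : Disjoint s'.val t'.val := h
  refine ⟨Equiv.Perm.sign (Set.powersetCard.permOfDisjoint h'), ?_⟩
  rw [← Finset.disjUnion_eq_union s t h]
  exact ExteriorAlgebra.basis_mul_of_disjoint (Pi.basisFun ℂ (Fin n)) s' t' h'

theorem extBasis_mul_of_not_disjoint {s t : Finset (Fin n)} (h : ¬ Disjoint s t) :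
    extBasis n s * extBasis n t = 0 :=
  ExteriorAlgebra.basis_mul_of_not_disjoint (Pi.basisFun ℂ (Fin n))
    (Set.powersetCard.ofCard rfl : Set.powersetCard (Fin n) s.card)
    (Set.powersetCard.ofCard rfl : Set.powersetCard (Fin n) t.card) h

theorem topCoeff_extBasis_mul_compl_ne_zero (s : Finset (Fin n)) :
    topCoeff n (extBasis n s * extBasis n sᶜ) ≠ 0 := by
  obtain ⟨ε, hε⟩ := extBasis_mul_of_disjoint (disjoint_compl_right (a := s))
  rw [hε, Finset.union_compl, Units.smul_def, map_zsmul, zsmul_eq_mul]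
  exact mul_ne_zero (Int.cast_ne_zero.2 ε.ne_zero) topCoeff_extBasis_univ_ne_zero

theorem topCoeff_extBasis_mul_compl_of_ne {s t : Finset (Fin n)} (hst : t ≠ s) :
    topCoeff n (extBasis n t * extBasis n sᶜ) = 0 := by
  by_cases ht : Disjoint t sᶜ
  · obtain ⟨ε, hε⟩ := extBasis_mul_of_disjoint ht
    rw [hε, Units.smul_def, map_zsmul, topCoeff_extBasis_of_ne, smul_zero]
    intro h
    refine hst (Finset.Subset.antisymm (disjoint_compl_right_iff.1 ht) fun i hi => ?_)
    have := h.symm ▸ Finset.mem_univ i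
    simpa [hi] using this
  · rw [extBasis_mul_of_not_disjoint ht, map_zero]

namespace PolyForm

/-- The coefficient of a differential form in the top degree. -/
noncomputable def top : PolyForm n →ₗ[MvPolynomial (Fin n) ℂ] MvPolynomial (Fin n) ℂ :=
  (TensorProduct.AlgebraTensorModule.rid ℂ (MvPolynomial (Fin n) ℂ)
    (MvPolynomial (Fin n) ℂ)).toLinearMap ∘ₗ (topCoeff n).baseChange (MvPolynomial (Fin n) ℂ)

theorem top_tmul (s : MvPolynomial (Fin n) ℂ) (x : ExteriorAlgebra ℂ (Fin n → ℂ)) :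
    top (s ⊗ₜ x) = topCoeff n x • s := by
  simp [top]

theorem one_tmul_ιMulti (k : ℕ) (v : Fin k → Fin n → ℂ) :
    (1 ⊗ₜ ExteriorAlgebra.ιMulti ℂ k v : PolyForm n) =
      (List.ofFn fun a => (1 ⊗ₜ ExteriorAlgebra.ι ℂ (v a) : PolyForm n)).prod := by
  rw [ExteriorAlgebra.ιMulti_apply]
  change Algebra.TensorProduct.includeRight (R := ℂ) (A := MvPolynomial (Fin n) ℂ) _ = _
  rw [map_list_prod, List.map_ofFn]
  rfl

theorem top_ofExterior_ιMulti (k : ℕ) (v : Fin k → Fin n → MvPolynomial (Fin n) ℂ) :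
    top (ofExterior (ExteriorAlgebra.ιMulti _ k v)) = topDet n _ k v := by
  suffices h : (top ∘ₗ ofExterior.toLinearMap).compAlternatingMap
      (ExteriorAlgebra.ιMulti (MvPolynomial (Fin n) ℂ) (M := Fin n → MvPolynomial (Fin n) ℂ) k) =
      topDet n _ k from DFunLike.congr_fun h v
  refine Module.Basis.ext_alternating (Pi.basisFun _ (Fin n)) fun τ hτ => ?_
  have h1 : ofExterior (ExteriorAlgebra.ιMulti (MvPolynomial (Fin n) ℂ) k
      fun a => (Pi.single (τ a) 1 : Fin n → MvPolynomial (Fin n) ℂ)) =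
      1 ⊗ₜ ExteriorAlgebra.ιMulti ℂ k fun a => (Pi.single (τ a) 1 : Fin n → ℂ) := by
    rw [one_tmul_ιMulti, ExteriorAlgebra.ιMulti_apply, map_list_prod, List.map_ofFn]
    congr 2
    ext1 a
    rw [Function.comp_apply, ofExterior_ι, oneForm_single]
  simp only [LinearMap.compAlternatingMap_apply, LinearMap.comp_apply, Pi.basisFun_apply,
    AlgHom.toLinearMap_apply, h1, top_tmul, topCoeff_ιMulti]
  by_cases hk : k = n
  · subst hk
    rw [topDet_self, topDet_self]
    change Matrix.det (Matrix.of fun a => (Pi.single (τ a) 1 : Fin k → ℂ)) • 1 =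
      Matrix.det (Matrix.of fun a => (Pi.single (τ a) 1 : Fin k → MvPolynomial (Fin k) ℂ))
    rw [smul_eq_C_mul, mul_one, RingHom.map_det]
    congr 1
    ext1 a j
    simp [Pi.single_apply, apply_ite]
  · simp [topDet_of_ne _ hk]

theorem top_ofMatrix (M : Matrix (Fin n) (Fin n) (MvPolynomial (Fin n) ℂ)) (x : PolyForm n) :
    top (ofMatrix M x) = M.det * top x := by
  suffices h : top ∘ₗ (ofMatrix M).toLinearMap = M.det • top from LinearMap.congr_fun h x
  refine TensorProduct.AlgebraTensorModule.curry_injective (LinearMap.ext_ring ?_)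
  refine ExteriorAlgebra.lhom_ext fun k => ?_
  ext1 v
  have h1 : ofMatrix M (1 ⊗ₜ ExteriorAlgebra.ιMulti ℂ k v) =
      ofExterior (ExteriorAlgebra.ιMulti _ k fun a => ∑ i, v a i • M.row i) := by
    rw [one_tmul_ιMulti, ExteriorAlgebra.ιMulti_apply, map_list_prod, List.map_ofFn,
      map_list_prod, List.map_ofFn]
    congr 2
    ext1 a
    simp only [Function.comp_apply, ofExterior_ι, ofMatrix_tmul_ι, one_smul]
  change top (ofMatrix M (1 ⊗ₜ ExteriorAlgebra.ιMulti ℂ k v)) =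
    M.det * top (1 ⊗ₜ ExteriorAlgebra.ιMulti ℂ k v)
  rw [h1, top_ofExterior_ιMulti, top_tmul, topCoeff_ιMulti]
  by_cases hk : k = n
  · subst hk
    rw [topDet_self, topDet_self]
    change Matrix.det _ = M.det * Matrix.det (Matrix.of v) • 1
    have h2 : (fun a => ∑ i, v a i • M.row i) = (Matrix.of v).map (C (σ := Fin k)) * M := by
      ext1 a
      ext1 j
      simp [Matrix.mul_apply, Matrix.row, Finset.sum_apply, MvPolynomial.smul_eq_C_mul]
    rw [h2, Matrix.det_mul, smul_eq_C_mul, mul_one, mul_comm, RingHom.map_det]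
    rfl
  · simp [topDet_of_ne _ hk]

/-- The action on differential forms of a linear change of variables. -/
noncomputable def subst (M : Matrix (Fin n) (Fin n) ℂ) : PolyForm n →ₐ[ℂ] PolyForm n :=
  Algebra.TensorProduct.map (linSubst M) (extMap M)

theorem subst_tmul (M : Matrix (Fin n) (Fin n) ℂ) (s : MvPolynomial (Fin n) ℂ)
    (x : ExteriorAlgebra ℂ (Fin n → ℂ)) : subst M (s ⊗ₜ x) = linSubst M s ⊗ₜ extMap M x :=
  Algebra.TensorProduct.map_tmul _ _ _ _

theorem subst_oneForm (M : Matrix (Fin n) (Fin n) ℂ) (v : Fin n → MvPolynomial (Fin n) ℂ) :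
    subst M (oneForm v) = oneForm (Matrix.vecMul (linSubst M ∘ v) (M.map C)) := by
  rw [oneForm_apply, map_sum, Matrix.vecMul_eq_sum, map_sum]
  refine Finset.sum_congr rfl fun i _ => ?_
  rw [subst_tmul, extMap_ι, TensorProduct.tmul_sum, map_smul, oneForm_apply, Finset.smul_sum]
  refine Finset.sum_congr rfl fun j _ => ?_
  rw [TensorProduct.smul_tmul', TensorProduct.tmul_smul, TensorProduct.smul_tmul', smul_eq_mul,
    Function.comp_apply, mul_comm, Matrix.map_apply, ← smul_eq_C_mul]

theorem algHom_ext_complex {A : Type*} [Ring A] [Algebra ℂ A] {φ ψ : PolyForm n →ₐ[ℂ] A}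
    (h : ∀ s, φ (s ⊗ₜ 1) = ψ (s ⊗ₜ 1))
    (h' : ∀ i, φ (oneForm (Pi.single i 1)) = ψ (oneForm (Pi.single i 1))) : φ = ψ := by
  refine Algebra.TensorProduct.ext (AlgHom.ext h) ?_
  refine ExteriorAlgebra.hom_ext ?_
  refine LinearMap.pi_ext' fun i => ?_
  ext
  simpa [oneForm_single] using h' i

theorem subst_eq_ofMatrix (M : Matrix (Fin n) (Fin n) ℂ) (x : PolyForm n) :
    subst M x = ofMatrix (M.map C) (Algebra.TensorProduct.map (linSubst M) (AlgHom.id ℂ _) x) := by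
  suffices h : subst M = ((ofMatrix (M.map C)).restrictScalars ℂ).comp
    (Algebra.TensorProduct.map (linSubst M) (AlgHom.id ℂ _)) from DFunLike.congr_fun h x
  refine algHom_ext_complex (fun s => ?_) fun i => ?_
  · rw [subst_tmul, map_one]
    simpa using ((ofMatrix (M.map C)).commutes (linSubst M s)).symm
  · rw [subst_oneForm, AlgHom.comp_apply, AlgHom.restrictScalars_apply, oneForm_single,
      Algebra.TensorProduct.map_tmul, map_one, AlgHom.id_apply, ← oneForm_single, ofMatrix_oneForm]
    congr 2
    ext1 j
    simp [Pi.single_apply, apply_ite]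

theorem top_map (φ : MvPolynomial (Fin n) ℂ →ₐ[ℂ] MvPolynomial (Fin n) ℂ) (x : PolyForm n) :
    top (Algebra.TensorProduct.map φ (AlgHom.id ℂ _) x) = φ (top x) := by
  induction x using TensorProduct.induction_on with
  | zero => simp
  | add x y hx hy => rw [map_add, map_add, map_add, map_add, hx, hy]
  | tmul s x =>
    rw [Algebra.TensorProduct.map_tmul, top_tmul, top_tmul, map_smul, AlgHom.id_apply]

theorem top_subst (M : Matrix (Fin n) (Fin n) ℂ) (x : PolyForm n) :
    top (subst M x) = M.det • linSubst M (top x) := by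
  rw [subst_eq_ofMatrix, top_ofMatrix, top_map, smul_eq_C_mul, RingHom.map_det]
  rfl

/-- The pullback of differential forms along a polynomial map. -/
noncomputable def pullback (f : Fin n → MvPolynomial (Fin n) ℂ) : PolyForm n →ₐ[ℂ] PolyForm n :=
  ((ofMatrix (jacobian f)).restrictScalars ℂ).comp
    (Algebra.TensorProduct.map (aeval f) (AlgHom.id ℂ _))

theorem pullback_tmul (f : Fin n → MvPolynomial (Fin n) ℂ) (s : MvPolynomial (Fin n) ℂ)
    (x : ExteriorAlgebra ℂ (Fin n → ℂ)) :
    pullback f (s ⊗ₜ x) = ofMatrix (jacobian f) (aeval f s ⊗ₜ x) := rfl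

theorem pullback_tmul_one (f : Fin n → MvPolynomial (Fin n) ℂ) (s : MvPolynomial (Fin n) ℂ) :
    pullback f (s ⊗ₜ 1) = aeval f s ⊗ₜ 1 := by
  rw [pullback_tmul]
  simpa using (ofMatrix (jacobian f)).commutes (aeval f s)

theorem pullback_oneForm_single (f : Fin n → MvPolynomial (Fin n) ℂ) (i : Fin n) :
    pullback f (oneForm (Pi.single i 1)) = oneForm ((jacobian f).row i) := by
  rw [oneForm_single, pullback_tmul, map_one, ← oneForm_single, ofMatrix_oneForm,
    Matrix.single_one_vecMul]

theorem _root_.IsBasicInvariants.subst_pullback (hf : IsBasicInvariants W f d) (w : W)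
    (x : PolyForm n) :
    subst (glMatrix (w : (Fin n → ℂ) ≃ₗ[ℂ] (Fin n → ℂ))) (pullback f x) = pullback f x := by
  suffices h : (subst (glMatrix (w : (Fin n → ℂ) ≃ₗ[ℂ] (Fin n → ℂ)))).comp (pullback f) =
    pullback f from DFunLike.congr_fun h x
  refine algHom_ext_complex (fun s => ?_) fun i => ?_
  · rw [AlgHom.comp_apply, pullback_tmul_one, subst_tmul, hf.linSubst_aeval, map_one]
  · rw [AlgHom.comp_apply, pullback_oneForm_single, subst_oneForm]
    congr 1
    exact congr_fun (hf.map_jacobian_mul w) i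

theorem exists_eq_sum (x : PolyForm n) :
    ∃ p : Finset (Fin n) → MvPolynomial (Fin n) ℂ, x = ∑ s, p s ⊗ₜ[ℂ] extBasis n s := by
  let b := Algebra.TensorProduct.basis (MvPolynomial (Fin n) ℂ) (extBasis n)
  refine ⟨fun s => b.repr x s, ?_⟩
  conv_lhs => rw [← b.sum_repr x]
  refine Finset.sum_congr rfl fun s _ => ?_
  rw [Algebra.TensorProduct.basis_apply, TensorProduct.smul_tmul', smul_eq_mul, mul_one]

theorem top_sum_mul (p : Finset (Fin n) → MvPolynomial (Fin n) ℂ) (s : Finset (Fin n)) :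
    top ((∑ t, p t ⊗ₜ[ℂ] extBasis n t) * (1 ⊗ₜ[ℂ] extBasis n sᶜ)) =
      topCoeff n (extBasis n s * extBasis n sᶜ) • p s := by
  rw [Finset.sum_mul, map_sum, Finset.sum_eq_single s]
  · rw [Algebra.TensorProduct.tmul_mul_tmul, top_tmul, mul_one]
  · intro t _ hts
    rw [Algebra.TensorProduct.tmul_mul_tmul, top_tmul, topCoeff_extBasis_mul_compl_of_ne hts,
      zero_smul]
  · simp

theorem eq_zero_of_top_mul {x : PolyForm n}
    (h : ∀ s, top (x * (1 ⊗ₜ[ℂ] extBasis n s)) = 0) : x = 0 := by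
  obtain ⟨p, rfl⟩ := exists_eq_sum x
  refine Finset.sum_eq_zero fun s _ => ?_
  have := h sᶜ
  rw [top_sum_mul] at this
  rw [(smul_eq_zero.1 this).resolve_left (topCoeff_extBasis_mul_compl_ne_zero s),
    TensorProduct.zero_tmul]

theorem eq_zero_of_top_mul_ofMatrix {M : Matrix (Fin n) (Fin n) (MvPolynomial (Fin n) ℂ)}
    (hM : M.det ≠ 0) {x : PolyForm n}
    (h : ∀ s, top (x * ofMatrix M (1 ⊗ₜ[ℂ] extBasis n s)) = 0) : x = 0 := by
  have h1 : ∀ z, top (x * ofMatrix M z) = 0 := by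
    intro z
    obtain ⟨p, rfl⟩ := exists_eq_sum z
    rw [map_sum, Finset.mul_sum, map_sum]
    refine Finset.sum_eq_zero fun s _ => ?_
    have h2 : (p s ⊗ₜ[ℂ] extBasis n s : PolyForm n) = p s • (1 ⊗ₜ[ℂ] extBasis n s) := by
      rw [TensorProduct.smul_tmul', smul_eq_mul, mul_one]
    rw [h2, map_smul, mul_smul_comm, map_smul, h, smul_zero]
  refine eq_zero_of_top_mul fun s => ?_
  have h3 := h1 (ofMatrix M.adjugate (1 ⊗ₜ[ℂ] extBasis n s))
  rw [← AlgHom.comp_apply, ofMatrix_comp, Matrix.adjugate_mul, ofMatrix_smul_one_extBasis,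
    ← smul_eq_mul (M.det ^ s.card), ← TensorProduct.smul_tmul', mul_smul_comm, map_smul] at h3
  exact (smul_eq_zero.1 h3).resolve_left (pow_ne_zero _ hM)

theorem top_pullback (x : PolyForm n) :
    top (pullback f x) = (jacobian f).det * aeval f (top x) := by
  rw [← top_map]
  exact top_ofMatrix _ _

end PolyForm

open PolyForm

theorem IsBasicInvariants.pullback_injective [Fintype W] (hf : IsBasicInvariants W f d) :
    Function.Injective (pullback f) := by
  refine (injective_iff_map_eq_zero _).2 fun x hx => eq_zero_of_top_mul fun s => ?_
  have h := top_pullback (f := f) (x * (1 ⊗ₜ[ℂ] extBasis n s))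
  rw [map_mul, hx, zero_mul, map_zero] at h
  exact (map_eq_zero_iff _ hf.2.2.1).1
    ((mul_eq_zero.1 h.symm).resolve_left hf.det_jacobian_ne_zero)

/-- **Solomon's theorem**: the invariant differential forms are the pullbacks of the differential
forms along the basic invariants. -/
theorem IsBasicInvariants.exists_pullback_eq [Fintype W] (hf : IsBasicInvariants W f d)
    {x : PolyForm n} (hx : ∀ w : W, subst (glMatrix (w : (Fin n → ℂ) ≃ₗ[ℂ] (Fin n → ℂ))) x = x) :
    ∃ q, pullback f q = x := by
  have h : ∀ s : Finset (Fin n), ∃ q : MvPolynomial (Fin n) ℂ, (jacobian f).det * aeval f q =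
      top (x * pullback f (1 ⊗ₜ[ℂ] extBasis n sᶜ)) := fun s =>
    hf.exists_eq_det_jacobian_mul fun w => by
      rw [← top_subst, map_mul, hx, hf.subst_pullback]
  choose q hq using h
  let c : Finset (Fin n) → ℂ := fun s => topCoeff n (extBasis n s * extBasis n sᶜ)
  refine ⟨∑ s, ((c s)⁻¹ • q s) ⊗ₜ[ℂ] extBasis n s, ?_⟩
  rw [← sub_eq_zero]
  refine eq_zero_of_top_mul_ofMatrix hf.det_jacobian_ne_zero fun s => ?_
  have h1 : ofMatrix (jacobian f) (1 ⊗ₜ[ℂ] extBasis n s) =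
      pullback f (1 ⊗ₜ[ℂ] extBasis n sᶜᶜ) := by
    rw [pullback_tmul, map_one, compl_compl]
  rw [h1, sub_mul, map_sub, ← hq, ← map_mul, top_pullback, top_sum_mul,
    smul_inv_smul₀ (topCoeff_extBasis_mul_compl_ne_zero _), sub_self]

namespace PolyForm

/-- Differential forms with coefficients homogeneous of degree `k`. -/
abbrev Graded (n k : ℕ) : Type :=
  homogeneousSubmodule (Fin n) ℂ k ⊗[ℂ] ExteriorAlgebra ℂ (Fin n → ℂ)

/-- The inclusion of the forms with coefficients homogeneous of degree `k`. -/
noncomputable def incl (n k : ℕ) : Graded n k →ₗ[ℂ] PolyForm n :=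
  LinearMap.rTensor _ (homogeneousSubmodule (Fin n) ℂ k).subtype

/-- The projection on the forms with coefficients homogeneous of degree `k`. -/
noncomputable def proj (n k : ℕ) : PolyForm n →ₗ[ℂ] Graded n k :=
  LinearMap.rTensor _ ((homogeneousComponent k).codRestrict (homogeneousSubmodule (Fin n) ℂ k)
    fun p => homogeneousComponent_mem k p)

theorem proj_incl {k l : ℕ} (h : k ≠ l) (u : Graded n l) : proj n k (incl n l u) = 0 := by
  rw [proj, incl, ← LinearMap.comp_apply, ← LinearMap.rTensor_comp]
  have h0 : (homogeneousComponent k).codRestrict (homogeneousSubmodule (Fin n) ℂ k)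
      (fun p => homogeneousComponent_mem k p) ∘ₗ
        (homogeneousSubmodule (Fin n) ℂ l).subtype = 0 := by
    ext1 p
    apply Subtype.ext
    change homogeneousComponent k (p : MvPolynomial (Fin n) ℂ) = 0
    rw [homogeneousComponent_of_mem p.2, if_neg h]
  rw [h0, LinearMap.rTensor_zero, LinearMap.zero_apply]

theorem proj_incl_self {k : ℕ} (u : Graded n k) : proj n k (incl n k u) = u := by
  rw [proj, incl, ← LinearMap.comp_apply, ← LinearMap.rTensor_comp]
  have h : (homogeneousComponent k).codRestrict (homogeneousSubmodule (Fin n) ℂ k)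
      (fun p => homogeneousComponent_mem k p) ∘ₗ (homogeneousSubmodule (Fin n) ℂ k).subtype =
      LinearMap.id := by
    ext1 p
    apply Subtype.ext
    change homogeneousComponent k (p : MvPolynomial (Fin n) ℂ) = p
    rw [homogeneousComponent_of_mem p.2, if_pos rfl]
  rw [h, LinearMap.rTensor_id, LinearMap.id_apply]

theorem incl_injective (k : ℕ) : Function.Injective (incl n k) :=
  Function.LeftInverse.injective proj_incl_self

theorem mul_mem_range_incl {k l : ℕ} {x y : PolyForm n} (hx : x ∈ LinearMap.range (incl n k))
    (hy : y ∈ LinearMap.range (incl n l)) : x * y ∈ LinearMap.range (incl n (k + l)) := by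
  obtain ⟨u, rfl⟩ := hx
  obtain ⟨v, rfl⟩ := hy
  induction u using TensorProduct.induction_on with
  | zero => simp
  | add u u' hu hu' =>
    rw [map_add, add_mul]
    exact Submodule.add_mem _ hu hu'
  | tmul s a =>
    induction v using TensorProduct.induction_on with
    | zero => simp
    | add v v' hv hv' =>
      rw [map_add, mul_add]
      exact Submodule.add_mem _ hv hv'
    | tmul t b =>
      exact ⟨⟨s.1 * t.1, IsHomogeneous.mul s.2 t.2⟩ ⊗ₜ (a * b),
        (Algebra.TensorProduct.tmul_mul_tmul _ _ _ _).symm⟩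

theorem tmul_mem_range_incl {k : ℕ} {s : MvPolynomial (Fin n) ℂ} (hs : s.IsHomogeneous k)
    (x : ExteriorAlgebra ℂ (Fin n → ℂ)) : s ⊗ₜ x ∈ LinearMap.range (incl n k) :=
  ⟨⟨s, hs⟩ ⊗ₜ x, rfl⟩

theorem ofMatrix_extBasis_mem_range_incl {M : Matrix (Fin n) (Fin n) (MvPolynomial (Fin n) ℂ)}
    {m : Fin n → ℕ} (hM : ∀ i j, (M i j).IsHomogeneous (m i)) (s : Finset (Fin n)) :
    ofMatrix M (1 ⊗ₜ extBasis n s) ∈ LinearMap.range (incl n (∑ i ∈ s, m i)) := by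
  obtain ⟨L, hL, rfl, h⟩ := exists_extBasis_eq_prod s
  rw [h, List.sum_toFinset _ hL]
  clear h hL
  induction L with
  | nil =>
    have h1 : ofMatrix M (1 ⊗ₜ[ℂ] 1) = 1 ⊗ₜ[ℂ] 1 := map_one (ofMatrix M)
    simp only [List.map_nil, List.prod_nil, h1]
    exact tmul_mem_range_incl (isHomogeneous_one _ _) _
  | cons i L ih =>
    have h1 : ((1 : MvPolynomial (Fin n) ℂ) ⊗ₜ[ℂ] ((i :: L).map fun i =>
        ExteriorAlgebra.ι ℂ (Pi.single i 1 : Fin n → ℂ)).prod : PolyForm n) =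
        oneForm (Pi.single i 1) * (1 ⊗ₜ[ℂ] (L.map fun i =>
        ExteriorAlgebra.ι ℂ (Pi.single i 1 : Fin n → ℂ)).prod) := by
      rw [List.map_cons, List.prod_cons, oneForm_single, Algebra.TensorProduct.tmul_mul_tmul,
        one_mul]
    rw [h1, map_mul, List.map_cons, List.sum_cons]
    refine mul_mem_range_incl ?_ ih
    rw [ofMatrix_oneForm, Matrix.single_one_vecMul, oneForm_apply]
    exact Submodule.sum_mem _ fun j _ => tmul_mem_range_incl (hM i j) _

theorem _root_.IsBasicInvariants.pullback_mem_range_incl (hf : IsBasicInvariants W f d)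
    (s : Finset (Fin n)) (a : Fin n →₀ ℕ) :
    pullback f (monomial a 1 ⊗ₜ extBasis n s) ∈
      LinearMap.range (incl n (Finsupp.weight d a + ∑ i ∈ s, (d i - 1))) := by
  have h : (monomial a 1 ⊗ₜ extBasis n s : PolyForm n) =
      (monomial a 1 ⊗ₜ 1) * (1 ⊗ₜ extBasis n s) := by
    rw [Algebra.TensorProduct.tmul_mul_tmul, mul_one, one_mul]
  rw [h, map_mul, pullback_tmul_one, pullback_tmul, map_one (aeval f)]
  exact mul_mem_range_incl (tmul_mem_range_incl (hf.isHomogeneous_aeval_monomial a) _)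
    (ofMatrix_extBasis_mem_range_incl (fun i _ => (hf.2.1 i).pderiv) s)

/-- The subset and monomial labels of the forms of weighted degree `k`. -/
noncomputable def labels (d : Fin n → ℕ) (hd : ∀ i, d i ≠ 0) (k : ℕ) :
    Finset (Σ _ : Finset (Fin n), Fin n →₀ ℕ) :=
  Finset.univ.sigma fun s =>
    if ∑ i ∈ s, (d i - 1) ≤ k then weightFinset d hd (k - ∑ i ∈ s, (d i - 1)) else ∅

theorem mem_labels {hd : ∀ i, d i ≠ 0} {k : ℕ} {j : Σ _ : Finset (Fin n), Fin n →₀ ℕ} :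
    j ∈ labels d hd k ↔ Finsupp.weight d j.2 + ∑ i ∈ j.1, (d i - 1) = k := by
  rw [labels, Finset.mem_sigma]
  split_ifs with h
  · simp only [Finset.mem_univ, true_and, mem_weightFinset]
    omega
  · simp only [Finset.notMem_empty, and_false, false_iff]
    omega

theorem sum_labels (hd : ∀ i, d i ≠ 0) (k : ℕ) (y : ℂ) :
    ∑ j ∈ labels d hd k, y ^ j.1.card = PowerSeries.coeff k
      (((∑ s : Finset (Fin n), Polynomial.C (y ^ s.card) * Polynomial.X ^ (∑ i ∈ s, (d i - 1)) :
        Polynomial ℂ) : PowerSeries ℂ) * weightSeries d hd 1) := by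
  rw [labels, Finset.sum_sigma, ← Polynomial.coeToPowerSeries.ringHom_apply, map_sum,
    Finset.sum_mul, map_sum]
  refine Finset.sum_congr rfl fun s _ => ?_
  dsimp only
  rw [Finset.sum_const, Polynomial.coeToPowerSeries.ringHom_apply, Polynomial.coe_mul,
    Polynomial.coe_pow, Polynomial.coe_C, Polynomial.coe_X,
    mul_assoc, PowerSeries.coeff_C_mul, PowerSeries.coeff_X_pow_mul', nsmul_eq_mul,
    mul_comm]
  split_ifs with h
  · rw [coeff_weightSeries_one]
  · simp

/-- The action on forms with coefficients homogeneous of degree `k`. -/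
noncomputable def substHom (k : ℕ) (M : Matrix (Fin n) (Fin n) ℂ) : Module.End ℂ (Graded n k) :=
  TensorProduct.map (linSubstHom k M) (extMap M).toLinearMap

theorem incl_substHom (k : ℕ) (M : Matrix (Fin n) (Fin n) ℂ) (u : Graded n k) :
    incl n k (substHom k M u) = subst M (incl n k u) := by
  induction u using TensorProduct.induction_on with
  | zero => simp
  | add u v hu hv => simp only [map_add, hu, hv]
  | tmul s x => rfl

/-- The endomorphism of the forms with coefficients homogeneous of degree `k` which multiplies
the forms of exterior degree `p` by `y ^ p`. -/
noncomputable def scaleHom (n k : ℕ) (y : ℂ) : Module.End ℂ (Graded n k) :=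
  LinearMap.lTensor _ (extMap (y • 1)).toLinearMap

theorem incl_scaleHom (k : ℕ) (y : ℂ) (u : Graded n k) :
    incl n k (scaleHom n k y u) = ofMatrix ((C y : MvPolynomial (Fin n) ℂ) • 1) (incl n k u) := by
  have h : (ofMatrix (n := n) ((C y : MvPolynomial (Fin n) ℂ) • 1)).restrictScalars ℂ =
      Algebra.TensorProduct.map (AlgHom.id ℂ _) (extMap (y • 1)) := by
    refine algHom_ext_complex (fun s => ?_) fun i => ?_
    · rw [Algebra.TensorProduct.map_tmul, map_one]
      simpa using (ofMatrix ((C y : MvPolynomial (Fin n) ℂ) • 1)).commutes s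
    · rw [AlgHom.restrictScalars_apply, ofMatrix_oneForm, Matrix.vecMul_smul, Matrix.vecMul_one,
        map_smul, oneForm_single, Algebra.TensorProduct.map_tmul, extMap_ι, Finset.sum_eq_single i]
      · simp [TensorProduct.smul_tmul', smul_eq_C_mul]
      · intro j _ hj
        simp [hj.symm]
      · simp
  induction u using TensorProduct.induction_on with
  | zero => simp
  | add u v hu hv => simp only [map_add, hu, hv]
  | tmul s x => exact (DFunLike.congr_fun h (s.1 ⊗ₜ x)).symm

end PolyForm

/-- The pullbacks of the monomial forms. -/
noncomputable def PolyForm.pullbackMonomial (f : Fin n → MvPolynomial (Fin n) ℂ)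
    (j : Σ _ : Finset (Fin n), Fin n →₀ ℕ) : PolyForm n :=
  pullback f (monomial j.2 1 ⊗ₜ extBasis n j.1)

theorem IsBasicInvariants.linearIndependent_pullbackMonomial [Fintype W]
    (hf : IsBasicInvariants W f d) : LinearIndependent ℂ (pullbackMonomial f) := by
  have h := ((basisMonomials (Fin n) ℂ).tensorProduct (extBasis n)).linearIndependent.map'
    (pullback f).toLinearMap (LinearMap.ker_eq_bot.2 hf.pullback_injective)
  have h1 := h.comp (fun j : Σ _ : Finset (Fin n), Fin n →₀ ℕ => (j.2, j.1)) (by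
    rintro ⟨s, a⟩ ⟨t, c⟩ h
    obtain ⟨rfl, rfl⟩ := Prod.mk.inj h
    rfl)
  have h2 : pullbackMonomial f = ((pullback f).toLinearMap ∘
      (basisMonomials (Fin n) ℂ).tensorProduct (extBasis n)) ∘
        fun j : Σ _ : Finset (Fin n), Fin n →₀ ℕ => (j.2, j.1) := by
    ext1 j
    rw [Function.comp_apply, Function.comp_apply, Module.Basis.tensorProduct_apply,
      coe_basisMonomials]
    rfl
  rw [h2]
  exact h1

theorem PolyForm.pullback_mem_span (q : PolyForm n) :
    pullback f q ∈ Submodule.span ℂ (Set.range (pullbackMonomial f)) := by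
  rw [← ((basisMonomials (Fin n) ℂ).tensorProduct (extBasis n)).linearCombination_repr q,
    Finsupp.linearCombination_apply, Finsupp.sum, map_sum]
  refine Submodule.sum_mem _ fun j _ => ?_
  rw [map_smul, Module.Basis.tensorProduct_apply, coe_basisMonomials]
  exact Submodule.smul_mem _ _ (Submodule.subset_span ⟨⟨j.2, j.1⟩, rfl⟩)

theorem PolyForm.ofMatrix_pullbackMonomial (y : ℂ) (j : Σ _ : Finset (Fin n), Fin n →₀ ℕ) :
    ofMatrix ((C y : MvPolynomial (Fin n) ℂ) • 1) (pullbackMonomial f j) =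
      y ^ j.1.card • pullbackMonomial f j := by
  have h : ∀ x : PolyForm n, ofMatrix ((C y : MvPolynomial (Fin n) ℂ) • 1)
      (ofMatrix (jacobian f) x) = ofMatrix (jacobian f)
      (ofMatrix ((C y : MvPolynomial (Fin n) ℂ) • 1) x) := fun x => by
    rw [← AlgHom.comp_apply, ofMatrix_comp, ← AlgHom.comp_apply, ofMatrix_comp, mul_smul_comm,
      mul_one, smul_mul_assoc, one_mul]
  rw [pullbackMonomial, pullback_tmul, h, ofMatrix_smul_one_extBasis, ← C_pow, ← smul_eq_C_mul,
    ← TensorProduct.smul_tmul']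
  exact map_smul ((ofMatrix (jacobian f)).restrictScalars ℂ) _ _

/-- The component of degree `k` of the pullback of a monomial form. -/
noncomputable def PolyForm.projPullback (f : Fin n → MvPolynomial (Fin n) ℂ) (k : ℕ)
    (j : Σ _ : Finset (Fin n), Fin n →₀ ℕ) : Graded n k :=
  proj n k (pullbackMonomial f j)

theorem IsBasicInvariants.incl_projPullback (hf : IsBasicInvariants W f d) {k : ℕ}
    {j : Σ _ : Finset (Fin n), Fin n →₀ ℕ}
    (hj : Finsupp.weight d j.2 + ∑ i ∈ j.1, (d i - 1) = k) :
    incl n k (projPullback f k j) = pullbackMonomial f j := by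
  subst hj
  obtain ⟨u, hu⟩ := hf.pullback_mem_range_incl j.1 j.2
  rw [projPullback, pullbackMonomial, ← hu, proj_incl_self]

theorem IsBasicInvariants.projPullback_eq_zero (hf : IsBasicInvariants W f d) {k : ℕ}
    {j : Σ _ : Finset (Fin n), Fin n →₀ ℕ}
    (hj : Finsupp.weight d j.2 + ∑ i ∈ j.1, (d i - 1) ≠ k) : projPullback f k j = 0 := by
  obtain ⟨u, hu⟩ := hf.pullback_mem_range_incl j.1 j.2
  rw [projPullback, pullbackMonomial, ← hu, proj_incl hj.symm]

theorem IsBasicInvariants.linearIndependent_projPullback [Fintype W]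
    (hf : IsBasicInvariants W f d) (k : ℕ) : LinearIndependent ℂ
      fun j : labels d hf.degree_ne_zero k => projPullback f k j := by
  refine LinearIndependent.of_comp (incl n k) ?_
  have h : (incl n k ∘ fun j : labels d hf.degree_ne_zero k => projPullback f k j) =
      fun j : labels d hf.degree_ne_zero k => pullbackMonomial f j := by
    ext1 j
    exact hf.incl_projPullback (mem_labels.1 j.2)
  rw [h]
  exact hf.linearIndependent_pullbackMonomial.comp _ Subtype.val_injective

theorem IsBasicInvariants.mem_span_projPullback [Fintype W] (hf : IsBasicInvariants W f d) {k : ℕ}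
    {u : Graded n k}
    (hu : ∀ w : W, substHom k (glMatrix (w : (Fin n → ℂ) ≃ₗ[ℂ] (Fin n → ℂ))) u = u) :
    u ∈ Submodule.span ℂ
      (Set.range fun j : labels d hf.degree_ne_zero k => projPullback f k j) := by
  obtain ⟨q, hq⟩ := hf.exists_pullback_eq (x := incl n k u) fun w => by
    rw [← incl_substHom, hu]
  rw [← proj_incl_self u, ← hq]
  have h := Submodule.mem_map_of_mem (f := proj n k) (pullback_mem_span (f := f) q)
  rw [Submodule.map_span] at h
  refine Submodule.span_le.2 ?_ h
  rintro _ ⟨_, ⟨j, rfl⟩, rfl⟩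
  by_cases hj : j ∈ labels d hf.degree_ne_zero k
  · exact Submodule.subset_span ⟨⟨j, hj⟩, rfl⟩
  · have h0 : proj n k (pullbackMonomial f j) = 0 :=
      hf.projPullback_eq_zero fun h => hj (mem_labels.2 h)
    rw [h0]
    exact Submodule.zero_mem _

theorem PolyForm.substHom_comp (k : ℕ) (M N : Matrix (Fin n) (Fin n) ℂ) :
    substHom k M ∘ₗ substHom k N = substHom k (N * M) := by
  rw [substHom, substHom, substHom, ← TensorProduct.map_comp, linSubstHom_comp,
    ← AlgHom.comp_toLinearMap, extMap_comp]

theorem PolyForm.trace_substHom_comp_scaleHom (k : ℕ) (M : Matrix (Fin n) (Fin n) ℂ) (y : ℂ) :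
    LinearMap.trace ℂ _ (substHom k M ∘ₗ scaleHom n k y) =
      LinearMap.trace ℂ _ (linSubstHom k M) *
        LinearMap.trace ℂ _ (extMap (y • M)).toLinearMap := by
  rw [substHom, scaleHom, LinearMap.map_comp_lTensor, LinearMap.trace_tensorProduct',
    ← AlgHom.comp_toLinearMap, extMap_comp, smul_mul_assoc, one_mul]

theorem IsBasicInvariants.sum_trace_linSubstHom_mul_trace_extMap [Fintype W]
    (hf : IsBasicInvariants W f d) (y : ℂ) (k : ℕ) :
    ∑ w : W, LinearMap.trace ℂ _
        (linSubstHom k (glMatrix (w : (Fin n → ℂ) ≃ₗ[ℂ] (Fin n → ℂ)))) *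
        LinearMap.trace ℂ _
          (extMap (y • glMatrix (w : (Fin n → ℂ) ≃ₗ[ℂ] (Fin n → ℂ)))).toLinearMap =
      Fintype.card W * ∑ j ∈ labels d hf.degree_ne_zero k, y ^ j.1.card := by
  have h := sum_trace_comp_eq
    (fun w : W => substHom k (glMatrix (w : (Fin n → ℂ) ≃ₗ[ℂ] (Fin n → ℂ))))
    (fun v w => by rw [PolyForm.substHom_comp, ← glMatrix_mul, Subgroup.coe_mul])
    (scaleHom n k y) (fun j : labels d hf.degree_ne_zero k => projPullback f k j)
    (fun j => y ^ j.1.1.card) (hf.linearIndependent_projPullback k)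
    (fun w j => incl_injective k (by
      rw [incl_substHom, hf.incl_projPullback (mem_labels.1 j.2), pullbackMonomial,
        hf.subst_pullback]))
    (fun u hu => hf.mem_span_projPullback hu)
    (fun j => incl_injective k (by
      rw [incl_scaleHom, map_smul, hf.incl_projPullback (mem_labels.1 j.2),
        ofMatrix_pullbackMonomial]))
  rw [← Finset.sum_coe_sort (labels d hf.degree_ne_zero k), ← h]
  exact Finset.sum_congr rfl fun w _ => (trace_substHom_comp_scaleHom k _ y).symm

/-- The bigraded Molien series of the algebra of invariant differential forms. -/
theorem IsBasicInvariants.sum_trace_extMap_div_det [Fintype W] (hf : IsBasicInvariants W f d)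
    (y : ℂ) {t : ℂ} (ht0 : t ≠ 0) (ht : ‖t‖ ≠ 1) :
    ∑ w : W, LinearMap.trace ℂ _
        (extMap (y • glMatrix (w : (Fin n → ℂ) ≃ₗ[ℂ] (Fin n → ℂ)))).toLinearMap /
        (1 - t • glMatrix (w : (Fin n → ℂ) ≃ₗ[ℂ] (Fin n → ℂ))).det =
      Fintype.card W * ∏ i, (1 + y * t ^ (d i - 1)) / (1 - t ^ d i) := by
  have h := (forall_sum_trace_linSubstHom_iff hf.degree_ne_zero
    (fun w : W => LinearMap.trace ℂ _
        (extMap (y • glMatrix (w : (Fin n → ℂ) ≃ₗ[ℂ] (Fin n → ℂ)))).toLinearMap)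
    (Polynomial.C (Fintype.card W : ℂ) * ∑ s : Finset (Fin n),
      Polynomial.C (y ^ s.card) * Polynomial.X ^ (∑ i ∈ s, (d i - 1)))).1 (fun k => ?_) t ht0 ht
  · rw [h, Finset.prod_div_distrib, Finset.prod_one_add, Finset.powerset_univ, ← mul_div_assoc]
    simp [Polynomial.eval_finsetSum, Finset.prod_mul_distrib, Finset.prod_pow_eq_pow_sum]
  · rw [Polynomial.coe_mul, Polynomial.coe_C, mul_assoc, PowerSeries.coeff_C_mul,
      ← sum_labels hf.degree_ne_zero, ← hf.sum_trace_linSubstHom_mul_trace_extMap]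
    exact Finset.sum_congr rfl fun w _ => mul_comm _ _

open Filter Topology in
theorem tendsto_one_add_mul_div_one_sub (x l : ℂ) :
    Tendsto (fun t : ℝ => (1 + (-1 + x * (1 - t)) * l) / (1 - l * t)) (𝓝[<] 1)
      (𝓝 (if l = 1 then x else 1)) := by
  split_ifs with hl
  · refine tendsto_const_nhds.congr' ?_
    filter_upwards [self_mem_nhdsWithin] with t ht
    have h : (1 - t : ℂ) ≠ 0 := sub_ne_zero.2 (by exact_mod_cast (ne_of_lt ht).symm)
    rw [hl, mul_one, one_mul, eq_div_iff h]
    ring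
  · have h : ContinuousAt (fun t : ℝ => (1 + (-1 + x * (1 - t)) * l) / (1 - l * t)) 1 := by
      refine ContinuousAt.div (by fun_prop) (by fun_prop) ?_
      simpa [sub_eq_zero] using Ne.symm hl
    have h1 := h.tendsto.mono_left (nhdsWithin_le_nhds (s := Set.Iio 1))
    have h2 : (1 - l : ℂ) ≠ 0 := sub_ne_zero.2 (Ne.symm hl)
    convert h1 using 2
    push_cast
    rw [sub_self, mul_zero, add_zero, mul_one, neg_one_mul, ← sub_eq_add_neg, div_self h2]

open Filter Topology in
theorem tendsto_one_add_mul_pow_div_one_sub_pow (x : ℂ) {m : ℕ} (hm : m ≠ 0) :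
    Tendsto (fun t : ℝ => (1 + (-1 + x * (1 - t)) * (t : ℂ) ^ (m - 1)) / (1 - (t : ℂ) ^ m)) (𝓝[<] 1)
      (𝓝 ((x + (m - 1)) / m)) := by
  obtain ⟨k, rfl⟩ := Nat.exists_eq_succ_of_ne_zero hm
  have h : ContinuousAt (fun t : ℝ => (x * (t : ℂ) ^ k + ∑ i ∈ Finset.range k, (t : ℂ) ^ i) /
      ∑ i ∈ Finset.range (k + 1), (t : ℂ) ^ i) 1 := by
    refine ContinuousAt.div (by fun_prop) (by fun_prop) ?_
    simpa using Nat.cast_add_one_ne_zero k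
  have h1 := h.tendsto.mono_left (nhdsWithin_le_nhds (s := Set.Iio 1))
  simp only [Complex.ofReal_one, one_pow, mul_one, Finset.sum_const, Finset.card_range,
    nsmul_eq_mul] at h1
  have h2 : (x + k) / ((k + 1 : ℕ) : ℂ) = (x + (((k.succ : ℕ) : ℂ) - 1)) / (k.succ : ℕ) := by
    push_cast
    rw [add_sub_cancel_right]
  rw [← h2]
  refine h1.congr' ?_
  filter_upwards [self_mem_nhdsWithin] with t ht
  have h3 : (1 - t : ℂ) ≠ 0 := sub_ne_zero.2 (by exact_mod_cast (ne_of_lt ht).symm)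
  rw [← mul_div_mul_left _ _ h3, mul_neg_geom_sum, mul_add, mul_neg_geom_sum]
  congr 1
  simp only [Nat.succ_eq_add_one, add_tsub_cancel_right]
  ring

open Filter Topology in
theorem IsBasicInvariants.sum_pow_finrank_fixedSpace [Fintype W] (hf : IsBasicInvariants W f d)
    (x : ℂ) :
    ∑ w : W, x ^ Module.finrank ℂ (fixedSpace (w : (Fin n → ℂ) ≃ₗ[ℂ] (Fin n → ℂ))) =
      Fintype.card W * ∏ i, (x + (d i - 1)) / d i := by
  have hex := fun w : W => exists_diagonal_of_isOfFinOrder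
    (w : (Fin n → ℂ) ≃ₗ[ℂ] (Fin n → ℂ)) (Submonoid.isOfFinOrder_coe.2 (isOfFinOrder_of_finite w))
  choose P Q l hPQ hQP hG _ hfix using hex
  have h1 : Tendsto (fun t : ℝ => ∑ w : W, LinearMap.trace ℂ _ (extMap ((-1 + x * (1 - t)) •
      glMatrix (w : (Fin n → ℂ) ≃ₗ[ℂ] (Fin n → ℂ)))).toLinearMap /
      (1 - (t : ℂ) • glMatrix (w : (Fin n → ℂ) ≃ₗ[ℂ] (Fin n → ℂ))).det) (𝓝[<] 1)
      (𝓝 (∑ w : W, x ^ Module.finrank ℂ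
        (fixedSpace (w : (Fin n → ℂ) ≃ₗ[ℂ] (Fin n → ℂ))))) := by
    refine tendsto_finsetSum _ fun w _ => ?_
    have h : ∀ y : ℂ, y • (P w * Matrix.diagonal (l w) * Q w) =
        P w * Matrix.diagonal (fun i => y * l w i) * Q w := fun y => by
      rw [← smul_mul_assoc, ← mul_smul_comm, ← Matrix.diagonal_smul]
      rfl
    rw [hfix, Finset.card_eq_sum_ones, Finset.sum_filter, ← Finset.prod_pow_eq_pow_sum]
    simp only [hG, det_one_sub_smul_conj (hPQ w)]
    simp only [h, trace_extMap_conj (hQP w), ← Finset.prod_div_distrib]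
    refine tendsto_finsetProd _ fun i _ => ?_
    convert tendsto_one_add_mul_div_one_sub x (l w i) using 2
    split_ifs <;> simp
  have h2 : Tendsto (fun t : ℝ => (Fintype.card W : ℂ) *
      ∏ i, (1 + (-1 + x * (1 - t)) * (t : ℂ) ^ (d i - 1)) / (1 - (t : ℂ) ^ d i)) (𝓝[<] 1)
      (𝓝 (Fintype.card W * ∏ i, (x + (d i - 1)) / d i)) :=
    tendsto_const_nhds.mul (tendsto_finsetProd _ fun i _ =>
      tendsto_one_add_mul_pow_div_one_sub_pow x (hf.degree_ne_zero i))
  refine tendsto_nhds_unique (h1.congr' ?_) h2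
  filter_upwards [Ioo_mem_nhdsLT (zero_lt_one (α := ℝ))] with t ht
  refine hf.sum_trace_extMap_div_det _ (Complex.ofReal_ne_zero.2 ht.1.ne') ?_
  rw [Complex.norm_real, Real.norm_of_nonneg ht.1.le]
  exact ht.2.ne

theorem finrank_fixedSpace_eq_iff (g : (Fin n → ℂ) ≃ₗ[ℂ] (Fin n → ℂ)) :
    Module.finrank ℂ (fixedSpace g) = n ↔ g = 1 := by
  constructor
  · intro h
    have h1 : fixedSpace g = ⊤ := Submodule.eq_top_of_finrank_eq (by simp [h])
    ext1 v
    have h2 : v ∈ fixedSpace g := h1 ▸ Submodule.mem_top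
    exact h2
  · rintro rfl
    have h1 : fixedSpace (1 : (Fin n → ℂ) ≃ₗ[ℂ] (Fin n → ℂ)) = ⊤ :=
      Submodule.eq_top_iff'.2 fun v => rfl
    rw [h1, finrank_top, Module.finrank_fin_fun]

end

open Polynomial in
/-- **Solomon's formula.** For a finite complex reflection group `W` with exponents
`m_i = d_i - 1`, one has `∑_{w ∈ W} x^{dim V^w} = ∏_{i=1}^{n} (x + m_i)`. -/
theorem solomon_formula (W : Subgroup ((Fin n → ℂ) ≃ₗ[ℂ] (Fin n → ℂ)))
    [Fintype W] (hW : IsReflectionGroup W)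
    (f : Fin n → MvPolynomial (Fin n) ℂ) (d : Fin n → ℕ)
    (hf : IsBasicInvariants W f d) :
    ∑ w : W, (Polynomial.X : Polynomial ℤ) ^
        (Module.finrank ℂ (fixedSpace (w : (Fin n → ℂ) ≃ₗ[ℂ] (Fin n → ℂ)))) =
      ∏ i, ((Polynomial.X : Polynomial ℤ) + Polynomial.C ((d i : ℤ) - 1)) := by
  have h : ∑ w : W, (Polynomial.X : Polynomial ℂ) ^
      (Module.finrank ℂ (fixedSpace (w : (Fin n → ℂ) ≃ₗ[ℂ] (Fin n → ℂ)))) =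
      Polynomial.C (Fintype.card W / ∏ i, (d i : ℂ)) *
        ∏ i, ((Polynomial.X : Polynomial ℂ) + Polynomial.C ((d i : ℂ) - 1)) := by
    refine Polynomial.funext fun x => ?_
    simp only [Polynomial.eval_finsetSum, Polynomial.eval_pow, Polynomial.eval_X,
      Polynomial.eval_mul, Polynomial.eval_C, Polynomial.eval_prod, Polynomial.eval_add]
    rw [hf.sum_pow_finrank_fixedSpace, Finset.prod_div_distrib]
    ring
  have hmonic : ∀ i ∈ Finset.univ,
      ((Polynomial.X : Polynomial ℂ) + Polynomial.C ((d i : ℂ) - 1)).Monic :=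
    fun i _ => Polynomial.monic_X_add_C _
  have hc := congrArg (fun p => Polynomial.coeff p n) h
  have hdeg : (∏ i, ((Polynomial.X : Polynomial ℂ) + Polynomial.C ((d i : ℂ) - 1))).natDegree =
      n := by
    rw [Polynomial.natDegree_prod_of_monic _ _ hmonic]
    simp only [Polynomial.natDegree_X_add_C, Finset.sum_const, Finset.card_univ, Fintype.card_fin,
      smul_eq_mul, mul_one]
  have hlead : (∏ i, ((Polynomial.X : Polynomial ℂ) + Polynomial.C ((d i : ℂ) - 1))).coeff n =
      1 := by
    have h1 := Polynomial.monic_prod_of_monic _ _ hmonic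
    rwa [Polynomial.Monic, Polynomial.leadingCoeff, hdeg] at h1
  have hcount : (∑ w : W, (Polynomial.X : Polynomial ℂ) ^ (Module.finrank ℂ
      (fixedSpace (w : (Fin n → ℂ) ≃ₗ[ℂ] (Fin n → ℂ))))).coeff n = 1 := by
    rw [Polynomial.finsetSum_coeff, Finset.sum_eq_single 1]
    · rw [Polynomial.coeff_X_pow, if_pos]
      exact ((finrank_fixedSpace_eq_iff _).2 rfl).symm
    · intro w _ hw
      rw [Polynomial.coeff_X_pow, if_neg]
      exact fun hn => hw (Subtype.ext ((finrank_fixedSpace_eq_iff _).1 hn.symm))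
    · simp
  rw [hcount, Polynomial.coeff_C_mul, hlead, mul_one] at hc
  rw [← hc, Polynomial.C_1, one_mul] at h
  refine Polynomial.map_injective (Int.castRingHom ℂ) Int.cast_injective ?_
  simpa [Polynomial.map_sum, Polynomial.map_prod] using h
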